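/- arXiv:1809.05631 — 2 statements merged into one kernel-verified Lean document; each statement's English description precedes it below -/
import Mathlib

section
/- If I_{ε,r} > −1, then the probability that the random hypergraph 𝔾(n,p₂,p₃) is propagation connected tends to 1 as n → ∞. -/
open MeasureTheory Real Filter

/-- Bernoulli-type measure on `Bool` with success probability `p`. -/
noncomputable def bern (p : ℝ) : Measure Bool :=
  (ENNReal.ofReal p) • Measure.dirac true + (ENNReal.ofReal (1 - p)) • Measure.dirac false

instance bern_finite (p : ℝ) : IsFiniteMeasure (bern p) := by
  constructor
  simp only [bern, Measure.coe_add, Measure.coe_smul, Pi.add_apply, Pi.smul_apply,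
    smul_eq_mul]
  finiteness

/-- Index type of potential edges: subsets of size 2 or 3. -/
abbrev EdgeIdx (n : ℕ) := {e : Finset (Fin n) // e.card = 2 ∨ e.card = 3}

/-- The law of the random hypergraph `𝔾(n, p₂, p₃)` with `p₂ = (1-ε)/n` and
`p₃ = r/(n ln n)`: the product of Bernoulli measures over all 2- and 3-subsets. -/
noncomputable def hypMeasure (n : ℕ) (ε r : ℝ) : Measure (EdgeIdx n → Bool) :=
  Measure.pi fun e =>
    bern (if e.1.card = 2 then (1 - ε) / n else r / (n * Real.log n))

/-- `e` is an edge of the configuration `ω`. -/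
def IsEdge {n : ℕ} (ω : EdgeIdx n → Bool) (e : Finset (Fin n)) : Prop :=
  ∃ h : e.card = 2 ∨ e.card = 3, ω ⟨e, h⟩ = true

/-- The constant `I_{ε,r} = -(1/r)(ε - ε²/2 + (1-ε)ln(1-ε))`. -/
noncomputable def Ier (ε r : ℝ) : ℝ :=
  -(1 / r) * (ε - ε ^ 2 / 2 + (1 - ε) * Real.log (1 - ε))

/-- The constant `K₀ = max {1, 2(9+ε)/r}`. -/
noncomputable def K0 (ε r : ℝ) : ℝ := max 1 (2 * (9 + ε) / r)

/-- Propagation connectivity: there is a sequence of edges `e₁, …, e_m` covering all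
vertices such that each subsequent edge meets the union of the previous ones in all
but exactly one vertex. (Here `f l` is the edge `e_{l+1}`.) -/
def PropConnected {n : ℕ} (ω : EdgeIdx n → Bool) : Prop :=
  ∃ (m : ℕ) (f : ℕ → Finset (Fin n)),
    (∀ i < m, IsEdge ω (f i)) ∧
    (Finset.range m).biUnion f = Finset.univ ∧
    ∀ l, 1 ≤ l → l < m →
      (f l ∩ (Finset.range l).biUnion f).card = (f l).card - 1

section ProductBernoulli

variable {ι : Type*}

/-- The event `A` is determined by the coordinates in `s`. -/
def DeterminedBy (A : Set (ι → Bool)) (s : Set ι) : Prop :=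
  ∀ ω ω' : ι → Bool, (∀ i ∈ s, ω i = ω' i) → ω ∈ A → ω' ∈ A

lemma determinedBy_all (s : Finset ι) (b : Bool) :
    DeterminedBy {ω : ι → Bool | ∀ i ∈ s, ω i = b} (s : Set ι) :=
  fun _ _ h hA i hi => (h i hi).symm.trans (hA i hi)

lemma DeterminedBy.compl {A : Set (ι → Bool)} {s : Set ι} (h : DeterminedBy A s) :
    DeterminedBy Aᶜ s :=
  fun ω ω' hω hA hA' => hA (h ω' ω (fun i hi => (hω i hi).symm) hA')

lemma DeterminedBy.mono {A : Set (ι → Bool)} {s t : Set ι} (h : DeterminedBy A s) (hst : s ⊆ t) :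
    DeterminedBy A t :=
  fun ω ω' hω => h ω ω' fun i hi => hω i (hst hi)

variable [Fintype ι] {p : ι → ℝ}

lemma isProbabilityMeasure_bern {q : ℝ} (h0 : 0 ≤ q) (h1 : q ≤ 1) :
    IsProbabilityMeasure (bern q) := by
  constructor
  simp only [bern, Measure.coe_add, Measure.coe_smul, Pi.add_apply, Pi.smul_apply,
    smul_eq_mul, measure_univ, mul_one]
  rw [← ENNReal.ofReal_add h0 (by linarith)]
  simp

/-- The product of Bernoulli measures with success probabilities `p i`. -/
noncomputable def prodBern (p : ι → ℝ) : Measure (ι → Bool) := Measure.pi fun i => bern (p i)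

lemma isProbabilityMeasure_prodBern (hp : ∀ i, 0 ≤ p i ∧ p i ≤ 1) :
    IsProbabilityMeasure (prodBern p) := by
  have := fun i => isProbabilityMeasure_bern (hp i).1 (hp i).2
  unfold prodBern
  infer_instance

lemma prodBern_inter (hp : ∀ i, 0 ≤ p i ∧ p i ≤ 1) {A B : Set (ι → Bool)} {s t : Set ι}
    (hA : DeterminedBy A s) (hB : DeterminedBy B t) (hst : Disjoint s t) :
    (prodBern p).real (A ∩ B) = (prodBern p).real A * (prodBern p).real B := by
  classical
  have := fun i => isProbabilityMeasure_bern (hp i).1 (hp i).2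
  have key : ProbabilityTheory.iIndepFun (fun i (ω : ι → Bool) => ω i) (prodBern p) := by
    unfold prodBern
    exact ProbabilityTheory.iIndepFun_pi (X := fun _ b => b) (fun i => aemeasurable_id)
  have h := key.indepFun_finset s.toFinset t.toFinset (by simpa using hst)
    (fun i => measurable_pi_apply i)
  have pre : ∀ (C : Set (ι → Bool)) (u : Set ι), DeterminedBy C u →
      C = (fun (ω : ι → Bool) (i : u.toFinset) => ω i) ⁻¹'
        ((fun (ω : ι → Bool) (i : u.toFinset) => ω i) '' C) := by
    intro C u hC
    ext ω
    refine ⟨fun h => ⟨ω, h, rfl⟩, ?_⟩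
    rintro ⟨ω', h', he⟩
    refine hC ω' ω (fun i hi => ?_) h'
    exact congrFun he ⟨i, by simpa using hi⟩
  rw [pre A s hA, pre B t hB]
  simp only [Measure.real]
  rw [h.measure_inter_preimage_eq_mul _ _ MeasurableSet.of_discrete MeasurableSet.of_discrete,
    ENNReal.toReal_mul]

lemma prodBern_box (hp : ∀ i, 0 ≤ p i ∧ p i ≤ 1) (s : Finset ι) (S : Set Bool) :
    (prodBern p).real {ω | ∀ i ∈ s, ω i ∈ S} = ∏ i ∈ s, (bern (p i)).real S := by
  classical
  have := fun i => isProbabilityMeasure_bern (hp i).1 (hp i).2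
  have : {ω : ι → Bool | ∀ i ∈ s, ω i ∈ S} = Set.pi Set.univ
      (fun i => if i ∈ s then S else Set.univ) := by
    ext ω
    simp only [Set.mem_ofPred_eq, Set.mem_pi, Set.mem_univ, true_implies]
    refine forall_congr' fun i => ?_
    split_ifs with h <;> simp [h]
  rw [this, prodBern, Measure.real, Measure.pi_pi, ENNReal.toReal_prod]
  rw [← Finset.prod_subset (Finset.subset_univ s)]
  · refine Finset.prod_congr rfl fun i hi => ?_
    simp [hi, Measure.real]
  · intro i _ hi
    rw [if_neg hi, measure_univ, ENNReal.toReal_one]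

lemma prodBern_all_true (hp : ∀ i, 0 ≤ p i ∧ p i ≤ 1) (s : Finset ι) :
    (prodBern p).real {ω | ∀ i ∈ s, ω i = true} = ∏ i ∈ s, p i := by
  have := prodBern_box hp s {true}
  simp only [Set.mem_singleton_iff] at this
  rw [this]
  refine Finset.prod_congr rfl fun i _ => ?_
  simp [bern, Measure.real, ENNReal.toReal_ofReal (hp i).1]

lemma prodBern_all_false (hp : ∀ i, 0 ≤ p i ∧ p i ≤ 1) (s : Finset ι) :
    (prodBern p).real {ω | ∀ i ∈ s, ω i = false} = ∏ i ∈ s, (1 - p i) := by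
  have := prodBern_box hp s {false}
  simp only [Set.mem_singleton_iff] at this
  rw [this]
  refine Finset.prod_congr rfl fun i _ => ?_
  simp [bern, Measure.real, ENNReal.toReal_ofReal (sub_nonneg.2 (hp i).2)]

lemma prodBern_biInter (hp : ∀ i, 0 ≤ p i ∧ p i ≤ 1) {κ : Type*} (R : Finset κ)
    (X : κ → Set (ι → Bool)) (F : κ → Set ι) (hX : ∀ w ∈ R, DeterminedBy (X w) (F w))
    (hF : (R : Set κ).PairwiseDisjoint F) :
    (prodBern p).real {ω | ∀ w ∈ R, ω ∈ X w} = ∏ w ∈ R, (prodBern p).real (X w) := by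
  classical
  have := isProbabilityMeasure_prodBern hp
  induction R using Finset.induction_on with
  | empty => simp
  | insert a R ha ih =>
    have hset : {ω | ∀ w ∈ insert a R, ω ∈ X w} = X a ∩ {ω | ∀ w ∈ R, ω ∈ X w} := by
      ext ω; simp
    rw [hset, Finset.prod_insert ha, ← ih (fun w hw => hX w (Finset.mem_insert_of_mem hw))
      (hF.subset (by simp))]
    refine prodBern_inter hp (hX a (Finset.mem_insert_self _ _)) (t := ⋃ w ∈ R, F w) ?_ ?_
    · intro ω ω' h hω w hw
      exact hX w (Finset.mem_insert_of_mem hw) ω ω'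
        (fun i hi => h i (Set.mem_biUnion hw hi)) (hω w hw)
    · rw [Set.disjoint_iUnion₂_right]
      intro w hw
      exact hF (by simp) (by simp [hw]) (fun h => ha (h ▸ hw))

end ProductBernoulli

section Propagation

variable {n : ℕ}

/-- The vertices that propagation along the edges contained in `U` reaches from `v`. -/
inductive Reach (ω : EdgeIdx n → Bool) (U : Finset (Fin n)) (v : Fin n) : Fin n → Prop
  | base : Reach ω U v v
  | step {e : Finset (Fin n)} {w : Fin n} : IsEdge ω e → e ⊆ U → w ∈ e →
      (∀ u ∈ e, u ≠ w → Reach ω U v u) → Reach ω U v w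

open Classical in
/-- The propagation closure of `v` inside `U`. -/
noncomputable def cl (ω : EdgeIdx n → Bool) (U : Finset (Fin n)) (v : Fin n) : Finset (Fin n) :=
  Finset.univ.filter (Reach ω U v)

variable {ω ω' : EdgeIdx n → Bool} {U U' C : Finset (Fin n)} {v w : Fin n}

@[simp] lemma mem_cl : w ∈ cl ω U v ↔ Reach ω U v w := by simp [cl]

lemma self_mem_cl : v ∈ cl ω U v := mem_cl.2 Reach.base

lemma cl_subset (hv : v ∈ U) : cl ω U v ⊆ U := by
  intro w hw
  rw [mem_cl] at hw
  induction hw with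
  | base => exact hv
  | step _ heU hwe _ _ => exact heU hwe

lemma cl_mono (h : U ⊆ U') : cl ω U v ⊆ cl ω U' v := by
  intro w hw
  rw [mem_cl] at hw ⊢
  induction hw with
  | base => exact Reach.base
  | step he heU hwe _ ih => exact Reach.step he (heU.trans h) hwe ih

lemma IsEdge.exists_ne {e : Finset (Fin n)} (he : IsEdge ω e) (w : Fin n) : ∃ u ∈ e, u ≠ w := by
  obtain ⟨h, -⟩ := he
  exact Finset.exists_mem_ne (by omega) w

lemma cl_congr (h : ∀ e : Finset (Fin n), ¬ Disjoint e (cl ω U v) → (IsEdge ω e ↔ IsEdge ω' e)) :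
    cl ω' U v = cl ω U v := by
  apply Finset.Subset.antisymm
  · intro w hw
    rw [mem_cl] at hw
    induction hw with
    | base => exact self_mem_cl
    | @step e w he heU hwe _ ih =>
      obtain ⟨u, hu, huw⟩ := he.exists_ne w
      have he' := (h e (Finset.not_disjoint_iff.2 ⟨u, hu, ih u hu huw⟩)).2 he
      exact mem_cl.2 (Reach.step he' heU hwe fun u hu huw => mem_cl.1 (ih u hu huw))
  · intro w hw
    rw [mem_cl] at hw ⊢
    induction hw with
    | base => exact Reach.base
    | @step e w he heU hwe hr ih =>
      obtain ⟨u, hu, huw⟩ := he.exists_ne w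
      have he' := (h e (Finset.not_disjoint_iff.2 ⟨u, hu, mem_cl.2 (hr u hu huw)⟩)).1 he
      exact Reach.step he' heU hwe ih

lemma cl_congr_of_subset (h : ∀ e : Finset (Fin n), e ⊆ U → (IsEdge ω e ↔ IsEdge ω' e)) :
    cl ω' U v = cl ω U v := by
  ext w
  simp only [mem_cl]
  constructor
  · intro hw
    induction hw with
    | base => exact Reach.base
    | step he heU hwe _ ih => exact Reach.step ((h _ heU).2 he) heU hwe ih
  · intro hw
    induction hw with
    | base => exact Reach.base
    | step he heU hwe _ ih => exact Reach.step ((h _ heU).1 he) heU hwe ih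

lemma cl_cl : cl ω (cl ω U v) v = cl ω U v := by
  apply Finset.Subset.antisymm (cl_subset self_mem_cl)
  intro w hw
  rw [mem_cl] at hw ⊢
  induction hw with
  | base => exact Reach.base
  | @step e w he heU hwe hr ih =>
    refine Reach.step he (fun u hu => ?_) hwe ih
    by_cases huw : u = w
    · subst huw
      exact mem_cl.2 (Reach.step he heU hwe hr)
    · exact mem_cl.2 (hr u hu huw)

lemma cl_closed {e : Finset (Fin n)} (he : IsEdge ω e) (heU : e ⊆ U) (hw : w ∈ e)
    (h : e.erase w ⊆ cl ω U v) : w ∈ cl ω U v :=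
  mem_cl.2 (Reach.step he heU hw fun _ hu huw => mem_cl.1 (h (Finset.mem_erase.2 ⟨huw, hu⟩)))

/-- Induction along a propagation sequence that exhausts the closure of `v`. -/
lemma cl_induction (Q : Finset (Fin n) → Prop) (h0 : Q {v})
    (hs : ∀ (W : Finset (Fin n)) (w : Fin n) (e : Finset (Fin n)), Q W → v ∈ W → w ∉ W →
      IsEdge ω e → e ⊆ U → w ∈ e → e.erase w ⊆ W → Q (insert w W)) : Q (cl ω U v) := by
  classical
  let F := (cl ω U v).powerset.filter fun W => v ∈ W ∧ Q W
  have hF : F.Nonempty := ⟨{v}, by simp [F, h0, Reach.base]⟩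
  obtain ⟨W, hW, hmax⟩ := F.exists_max_image Finset.card hF
  simp only [F, Finset.mem_filter, Finset.mem_powerset] at hW hmax
  obtain ⟨hWc, hvW, hQ⟩ := hW
  suffices h : cl ω U v ⊆ W by rwa [← Finset.Subset.antisymm hWc h]
  intro w hw
  rw [mem_cl] at hw
  induction hw with
  | base => exact hvW
  | @step e w he heU hwe _ ih =>
    by_contra hwW
    have hsub : e.erase w ⊆ W := fun u hu =>
      ih u (Finset.mem_of_mem_erase hu) (Finset.ne_of_mem_erase hu)
    have := hmax (insert w W) ⟨Finset.insert_subset (cl_closed he heU hwe (hsub.trans hWc)) hWc,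
      Finset.mem_insert_of_mem hvW, hs W w e hQ hvW hwW he heU hwe hsub⟩
    rw [Finset.card_insert_of_notMem hwW] at this
    omega

lemma propConnected_of_cl_eq_univ (hn : 2 ≤ n) (h : cl ω Finset.univ v = Finset.univ) :
    PropConnected ω := by
  classical
  have key := cl_induction (ω := ω) (U := Finset.univ) (v := v)
    (fun W => W = {v} ∨ ∃ (m : ℕ) (f : ℕ → Finset (Fin n)), 1 ≤ m ∧
      (∀ i < m, IsEdge ω (f i)) ∧ (Finset.range m).biUnion f = W ∧
      ∀ l, 1 ≤ l → l < m → (f l ∩ (Finset.range l).biUnion f).card = (f l).card - 1)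
    (Or.inl rfl) ?_
  · rw [h] at key
    rcases key with key | ⟨m, f, -, h1, h2, h3⟩
    · have := congrArg Finset.card key
      simp at this
      omega
    · exact ⟨m, f, h1, h2, h3⟩
  · intro W w e hQ hvW hwW he _ hwe hsub
    right
    rcases hQ with rfl | ⟨m, f, hm, h1, h2, h3⟩
    · refine ⟨1, fun _ => e, le_rfl, fun _ _ => he, ?_, fun l hl hl' => by omega⟩
      obtain ⟨u, hu, huw⟩ := he.exists_ne w
      have huv : u = v := by simpa using hsub (Finset.mem_erase.2 ⟨huw, hu⟩)
      subst huv
      ext x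
      simp only [Finset.mem_biUnion, Finset.mem_range, Finset.mem_insert, Finset.mem_singleton]
      constructor
      · rintro ⟨_, _, hx⟩
        by_cases hxw : x = w
        · exact Or.inl hxw
        · exact Or.inr (by simpa using hsub (Finset.mem_erase.2 ⟨hxw, hx⟩))
      · rintro (rfl | rfl)
        · exact ⟨0, by simp, hwe⟩
        · exact ⟨0, by simp, hu⟩
    · have hf : ∀ i < m, Function.update f m e i = f i := fun i hi =>
        Function.update_of_ne (by omega) _ _
      have hU : ∀ l ≤ m, (Finset.range l).biUnion (Function.update f m e)
          = (Finset.range l).biUnion f := fun l hl =>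
        Finset.biUnion_congr rfl fun i hi => hf i (by have := Finset.mem_range.1 hi; omega)
      refine ⟨m + 1, Function.update f m e, by omega, fun i hi => ?_, ?_, fun l hl hl' => ?_⟩
      · rcases Nat.lt_succ_iff_lt_or_eq.1 hi with hi | rfl
        · rw [hf i hi]; exact h1 i hi
        · simpa using he
      · rw [Finset.range_add_one, Finset.biUnion_insert, hU m le_rfl, h2,
          Function.update_self]
        ext x
        simp only [Finset.mem_union, Finset.mem_insert]
        constructor
        · rintro (hx | hx)
          · by_cases hxw : x = w
            · exact Or.inl hxw
            · exact Or.inr (hsub (Finset.mem_erase.2 ⟨hxw, hx⟩))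
          · exact Or.inr hx
        · rintro (rfl | hx)
          · exact Or.inl hwe
          · exact Or.inr hx
      · rw [hU l (by omega)]
        rcases Nat.lt_succ_iff_lt_or_eq.1 hl' with hl' | rfl
        · rw [hf l hl']; exact h3 l hl hl'
        · rw [Function.update_self, h2, ← Finset.card_erase_of_mem hwe]
          congr 1
          ext x
          simp only [Finset.mem_inter, Finset.mem_erase]
          constructor
          · rintro ⟨hx, hxW⟩
            exact ⟨fun h => hwW (h ▸ hxW), hx⟩
          · rintro ⟨hxw, hx⟩
            exact ⟨hx, hsub (Finset.mem_erase.2 ⟨hxw, hx⟩)⟩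

/-- Every vertex other than the root can be charged to a private edge that contains it. -/
lemma exists_injOn_edges :
    ∃ g : Fin n → Finset (Fin n), (∀ w ∈ cl ω U v, w ≠ v →
      IsEdge ω (g w) ∧ w ∈ g w ∧ g w ⊆ cl ω U v) ∧
      Set.InjOn g ((cl ω U v).erase v : Finset (Fin n)) := by
  classical
  refine cl_induction (ω := ω) (U := U) (v := v)
    (fun W => ∃ g : Fin n → Finset (Fin n), (∀ w ∈ W, w ≠ v →
      IsEdge ω (g w) ∧ w ∈ g w ∧ g w ⊆ W) ∧ Set.InjOn g (W.erase v : Finset (Fin n)))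
    ⟨fun _ => ∅, by simp⟩ ?_
  rintro W w e ⟨g, hg, hinj⟩ hvW hwW he - hwe hsub
  have hgW : ∀ u ∈ W, Function.update g w e u = g u := fun u hu =>
    Function.update_of_ne (ne_of_mem_of_not_mem hu hwW) _ _
  have hne : ∀ u ∈ W, u ≠ v → g u ≠ e := fun u hu huv h =>
    hwW ((hg u hu huv).2.2 (by rw [h]; exact hwe))
  refine ⟨Function.update g w e, fun u hu huv => ?_, fun a ha b hb hab => ?_⟩
  · rcases Finset.mem_insert.1 hu with rfl | hu
    · rw [Function.update_self]
      refine ⟨he, hwe, fun x hx => ?_⟩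
      by_cases hxu : x = u
      · exact hxu ▸ Finset.mem_insert_self _ _
      · exact Finset.mem_insert_of_mem (hsub (Finset.mem_erase.2 ⟨hxu, hx⟩))
    · rw [hgW u hu]
      obtain ⟨h1, h2, h3⟩ := hg u hu huv
      exact ⟨h1, h2, h3.trans (Finset.subset_insert _ _)⟩
  · simp only [Finset.coe_erase, Set.mem_sdiff, Finset.mem_coe, Finset.mem_insert,
      Set.mem_singleton_iff] at ha hb
    obtain ⟨ha, hav⟩ := ha
    obtain ⟨hb, hbv⟩ := hb
    rcases ha with rfl | ha <;> rcases hb with rfl | hb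
    · rfl
    · rw [Function.update_self, hgW b hb] at hab
      exact absurd hab.symm (hne b hb hbv)
    · rw [Function.update_self, hgW a ha] at hab
      exact absurd hab (hne a ha hav)
    · rw [hgW a ha, hgW b hb] at hab
      exact hinj (by simp [ha, hav]) (by simp [hb, hbv]) hab

end Propagation

section Spanning

variable {n : ℕ} {p₂ p₃ : ℝ}

/-- The edge probabilities of `𝔾(n, p₂, p₃)`. -/
noncomputable def edgeProb (n : ℕ) (p₂ p₃ : ℝ) (e : EdgeIdx n) : ℝ :=
  if e.1.card = 2 then p₂ else p₃

lemma edgeProb_mem (h₂ : 0 ≤ p₂ ∧ p₂ ≤ 1) (h₃ : 0 ≤ p₃ ∧ p₃ ≤ 1) (e : EdgeIdx n) :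
    0 ≤ edgeProb n p₂ p₃ e ∧ edgeProb n p₂ p₃ e ≤ 1 := by
  unfold edgeProb
  split_ifs
  exacts [h₂, h₃]

open Classical in
lemma sum_edgeProb_le (h₂ : 0 ≤ p₂) (h₃ : 0 ≤ p₃) (C : Finset (Fin n)) (w : Fin n) :
    ∑ e ∈ Finset.univ.filter (fun e : EdgeIdx n => w ∈ e.1 ∧ e.1 ⊆ C), edgeProb n p₂ p₃ e
      ≤ C.card * p₂ + (C.card : ℝ) ^ 2 / 2 * p₃ := by
  have count : ∀ j : ℕ, ((Finset.univ.filter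
      (fun e : EdgeIdx n => w ∈ e.1 ∧ e.1 ⊆ C)).filter (fun e => e.1.card = j + 1)).card
      ≤ C.card.choose j := by
    intro j
    rw [← Finset.card_powersetCard]
    refine Finset.card_le_card_of_injOn (fun e => e.1.erase w) ?_ ?_
    · intro e he
      simp only [Finset.coe_filter, Finset.mem_filter, Finset.mem_univ, true_and,
        Set.mem_ofPred_eq] at he
      rw [Finset.mem_coe, Finset.mem_powersetCard]
      refine ⟨(Finset.erase_subset _ _).trans he.1.2, ?_⟩
      rw [Finset.card_erase_of_mem he.1.1, he.2]
      rfl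
    · intro e he e' he' h
      simp only [Finset.coe_filter, Finset.mem_filter, Finset.mem_univ, true_and,
        Set.mem_ofPred_eq] at he he'
      apply Subtype.ext
      rw [← Finset.insert_erase he.1.1, ← Finset.insert_erase he'.1.1]
      exact congrArg (insert w) h
  rw [← Finset.sum_filter_add_sum_filter_not _ (fun e : EdgeIdx n => e.1.card = 2)]
  refine add_le_add ?_ ?_
  · rw [Finset.sum_congr rfl (g := fun _ => p₂) (by
      intro e he
      rw [Finset.mem_filter] at he
      simp [edgeProb, he.2]), Finset.sum_const, nsmul_eq_mul]
    have := count 1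
    rw [Nat.choose_one_right] at this
    gcongr
  · rw [Finset.sum_congr rfl (g := fun _ => p₃) (by
      intro e he
      rw [Finset.mem_filter] at he
      simp [edgeProb, he.2]), Finset.sum_const, nsmul_eq_mul]
    have h3 : ∀ e : EdgeIdx n, ¬ e.1.card = 2 ↔ e.1.card = 3 := fun e => by
      have := e.2
      omega
    simp only [h3]
    have hc := count 2
    have : (C.card.choose 2 : ℝ) ≤ (C.card : ℝ) ^ 2 / 2 := by
      have := Nat.choose_le_pow_div (α := ℝ) 2 C.card
      simpa using this
    gcongr
    exact le_trans (by exact_mod_cast hc) this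

lemma prodBern_cl_eq_le (h₂ : 0 ≤ p₂ ∧ p₂ ≤ 1) (h₃ : 0 ≤ p₃ ∧ p₃ ≤ 1) (C : Finset (Fin n))
    (v : Fin n) :
    (prodBern (edgeProb n p₂ p₃)).real {ω | cl ω C v = C}
      ≤ (C.card * p₂ + (C.card : ℝ) ^ 2 / 2 * p₃) ^ (C.card - 1) := by
  classical
  have hp := edgeProb_mem (n := n) h₂ h₃
  have := isProbabilityMeasure_prodBern hp
  have hD : 0 ≤ C.card * p₂ + (C.card : ℝ) ^ 2 / 2 * p₃ := by
    have := h₂.1; have := h₃.1; positivity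
  by_cases hv : v ∈ C
  swap
  · have : {ω : EdgeIdx n → Bool | cl ω C v = C} = ∅ := by
      ext ω
      simp only [Set.mem_ofPred_eq, Set.mem_empty_iff_false, iff_false]
      exact fun h => hv (h ▸ self_mem_cl)
    rw [this]
    simpa using pow_nonneg hD _
  let ι := {w : Fin n // w ∈ C.erase v}
  let t : ι → Finset (EdgeIdx n) := fun w => Finset.univ.filter fun e => w.1 ∈ e.1 ∧ e.1 ⊆ C
  let T : Finset (ι → EdgeIdx n) := (Fintype.piFinset t).filter Function.Injective
  have hsub : {ω : EdgeIdx n → Bool | cl ω C v = C} ⊆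
      ⋃ g ∈ T, {ω | ∀ e ∈ Finset.univ.image g, ω e = true} := by
    intro ω hω
    obtain ⟨g, hg, hinj⟩ := exists_injOn_edges (ω := ω) (U := C) (v := v)
    rw [Set.mem_ofPred_eq] at hω
    rw [hω] at hg hinj
    have hw : ∀ w : ι, IsEdge ω (g w.1) ∧ w.1 ∈ g w.1 ∧ g w.1 ⊆ C := fun w =>
      hg w.1 (Finset.mem_of_mem_erase w.2) (Finset.ne_of_mem_erase w.2)
    rw [Set.mem_iUnion₂]
    refine ⟨fun w => ⟨g w.1, (hw w).1.1⟩, ?_, ?_⟩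
    · simp only [T, Finset.mem_filter, Fintype.mem_piFinset, t, Finset.mem_univ, true_and]
      refine ⟨fun w => (hw w).2, fun a b hab => ?_⟩
      exact Subtype.ext (hinj a.2 b.2 (congrArg Subtype.val hab))
    · intro e he
      obtain ⟨w, -, rfl⟩ := Finset.mem_image.1 he
      exact (hw w).1.2
  calc (prodBern (edgeProb n p₂ p₃)).real {ω | cl ω C v = C}
      ≤ ∑ g ∈ T, (prodBern (edgeProb n p₂ p₃)).real
          {ω | ∀ e ∈ Finset.univ.image g, ω e = true} :=
        (measureReal_mono hsub (measure_ne_top _ _)).trans (measureReal_biUnion_finset_le _ _)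
    _ = ∑ g ∈ T, ∏ w, edgeProb n p₂ p₃ (g w) := by
        refine Finset.sum_congr rfl fun g hg => ?_
        rw [prodBern_all_true hp, Finset.prod_image]
        exact fun a _ b _ hab => (Finset.mem_filter.1 hg).2 hab
    _ ≤ ∑ g ∈ Fintype.piFinset t, ∏ w, edgeProb n p₂ p₃ (g w) :=
        Finset.sum_le_sum_of_subset_of_nonneg (Finset.filter_subset _ _)
          fun g _ _ => Finset.prod_nonneg fun w _ => (hp _).1
    _ = ∏ w : ι, ∑ e ∈ t w, edgeProb n p₂ p₃ e := (Finset.prod_univ_sum _ _).symm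
    _ ≤ ∏ _w : ι, (C.card * p₂ + (C.card : ℝ) ^ 2 / 2 * p₃) :=
        Finset.prod_le_prod (fun w _ => Finset.sum_nonneg fun e _ => (hp e).1)
          fun w _ => sum_edgeProb_le h₂.1 h₃.1 C w.1
    _ = _ := by
        rw [Finset.prod_const, Finset.card_univ, Fintype.card_coe, Finset.card_erase_of_mem hv]

/-- No edge consists of a pair of vertices in `C` and a vertex outside of `C`. -/
def TripleClosed (ω : EdgeIdx n → Bool) (C : Finset (Fin n)) : Prop :=
  ∀ a ⊆ C, a.card = 2 → ∀ w ∉ C, ¬ IsEdge ω (insert w a)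

lemma tripleClosed_cl (ω : EdgeIdx n → Bool) (v : Fin n) :
    TripleClosed ω (cl ω Finset.univ v) := by
  intro a ha _ w hw he
  refine hw (cl_closed he (Finset.subset_univ _) (Finset.mem_insert_self _ _) ?_)
  exact (Finset.erase_insert_subset _ _).trans ha

lemma prodBern_tripleClosed_le (h₂ : 0 ≤ p₂ ∧ p₂ ≤ 1) (h₃ : 0 ≤ p₃ ∧ p₃ ≤ 1)
    (C : Finset (Fin n)) :
    (prodBern (edgeProb n p₂ p₃)).real {ω | TripleClosed ω C}
      ≤ Real.exp (-((n - C.card : ℝ) * (C.card.choose 2) * p₃)) := by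
  classical
  have hp := edgeProb_mem (n := n) h₂ h₃
  have := isProbabilityMeasure_prodBern hp
  have hcard : ∀ x : {x // x ∈ C.powersetCard 2 ×ˢ Cᶜ}, (insert x.1.2 x.1.1).card = 3 := by
    rintro ⟨⟨a, w⟩, hx⟩
    rw [Finset.mem_product, Finset.mem_powersetCard, Finset.mem_compl] at hx
    rw [Finset.card_insert_of_notMem (fun h => hx.2 (hx.1.1 h)), hx.1.2]
  let F : Finset (EdgeIdx n) := (C.powersetCard 2 ×ˢ Cᶜ).attach.image
    fun x => ⟨insert x.1.2 x.1.1, Or.inr (hcard x)⟩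
  have hF : F.card = (n - C.card) * C.card.choose 2 := by
    rw [Finset.card_image_of_injective, Finset.card_attach, Finset.card_product,
      Finset.card_powersetCard, Finset.card_compl, Fintype.card_fin, mul_comm]
    rintro ⟨⟨a, w⟩, hx⟩ ⟨⟨b, u⟩, hy⟩ h
    simp only [Finset.mem_product, Finset.mem_powersetCard, Finset.mem_compl] at hx hy
    have h' : insert w a = insert u b := congrArg Subtype.val h
    have hwu : w = u := by
      have : w ∈ insert u b := h' ▸ Finset.mem_insert_self _ _
      rcases Finset.mem_insert.1 this with h | h
      · exact h
      · exact absurd (hy.1.1 h) hx.2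
    subst hwu
    have hab : a = b := by
      rw [← Finset.erase_insert (fun h => hx.2 (hx.1.1 h) : w ∉ a), h',
        Finset.erase_insert (fun h => hy.2 (hy.1.1 h) : w ∉ b)]
    subst hab
    rfl
  have hsub : {ω : EdgeIdx n → Bool | TripleClosed ω C} ⊆ {ω | ∀ e ∈ F, ω e = false} := by
    intro ω hω e he
    obtain ⟨x, -, rfl⟩ := Finset.mem_image.1 he
    have hx := x.2
    rw [Finset.mem_product, Finset.mem_powersetCard, Finset.mem_compl] at hx
    have := hω x.1.1 hx.1.1 hx.1.2 x.1.2 hx.2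
    by_contra hne
    exact this ⟨Or.inr (hcard x), by simpa using hne⟩
  have hle : C.card ≤ n := by simpa using C.card_le_univ
  calc (prodBern (edgeProb n p₂ p₃)).real {ω | TripleClosed ω C}
      ≤ (prodBern (edgeProb n p₂ p₃)).real {ω | ∀ e ∈ F, ω e = false} :=
        measureReal_mono hsub (measure_ne_top _ _)
    _ = ∏ e ∈ F, (1 - edgeProb n p₂ p₃ e) := prodBern_all_false hp F
    _ = ∏ e ∈ F, (1 - p₃) := by
        refine Finset.prod_congr rfl fun e he => ?_
        obtain ⟨x, -, rfl⟩ := Finset.mem_image.1 he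
        simp [edgeProb, hcard x]
    _ = (1 - p₃) ^ ((n - C.card) * C.card.choose 2) := by rw [Finset.prod_const, hF]
    _ ≤ (Real.exp (-p₃)) ^ ((n - C.card) * C.card.choose 2) := by
        have := Real.add_one_le_exp (-p₃)
        exact pow_le_pow_left₀ (by linarith [h₃.2]) (by linarith) _
    _ = _ := by
        rw [← Real.exp_nat_mul]
        push_cast [Nat.cast_sub hle]
        ring_nf

lemma determinedBy_cl_eq (C : Finset (Fin n)) (v : Fin n) :
    DeterminedBy {ω : EdgeIdx n → Bool | cl ω C v = C} {e | e.1 ⊆ C} := by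
  intro ω ω' h hω
  refine (cl_congr_of_subset fun e he => ?_).trans hω
  exact exists_congr fun h' => by rw [h ⟨e, h'⟩ he]

lemma determinedBy_tripleClosed (C : Finset (Fin n)) :
    DeterminedBy {ω : EdgeIdx n → Bool | TripleClosed ω C} {e | ¬ e.1 ⊆ C} := by
  rintro ω ω' h hω a ha hac w hw ⟨h', he⟩
  refine hω a ha hac w hw ⟨h', ?_⟩
  rw [h _ fun hs => hw (hs (Finset.mem_insert_self _ _)), he]

/-- Union bound for the existence of a propagation closure of intermediate size. -/
lemma prodBern_exists_cl_le (h₂ : 0 ≤ p₂ ∧ p₂ ≤ 1) (h₃ : 0 ≤ p₃ ∧ p₃ ≤ 1) (K : ℕ) :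
    (prodBern (edgeProb n p₂ p₃)).real
      {ω | ∃ v, K ≤ (cl ω Finset.univ v).card ∧ (cl ω Finset.univ v).card < n}
      ≤ ∑ k ∈ Finset.Ico K n, n.choose k *
        (min 1 (k * (k * p₂ + (k : ℝ) ^ 2 / 2 * p₃) ^ (k - 1)) *
          Real.exp (-((n - k : ℝ) * (k.choose 2) * p₃))) := by
  classical
  have hp := edgeProb_mem (n := n) h₂ h₃
  have := isProbabilityMeasure_prodBern hp
  set μ := prodBern (edgeProb n p₂ p₃) with hμ
  let X : Finset (Fin n) → Set (EdgeIdx n → Bool) := fun C => ⋃ v ∈ C, {ω | cl ω C v = C}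
  have hXd : ∀ C, DeterminedBy (X C) {e | e.1 ⊆ C} := by
    intro C ω ω' h hω
    obtain ⟨v, hv, hω⟩ := Set.mem_iUnion₂.1 hω
    exact Set.mem_iUnion₂.2 ⟨v, hv, determinedBy_cl_eq C v ω ω' h hω⟩
  have hX : ∀ C, μ.real (X C) ≤
      min 1 (C.card * (C.card * p₂ + (C.card : ℝ) ^ 2 / 2 * p₃) ^ (C.card - 1)) := by
    intro C
    refine le_min measureReal_le_one ((measureReal_biUnion_finset_le _ _).trans ?_)
    refine (Finset.sum_le_sum fun v _ => prodBern_cl_eq_le h₂ h₃ C v).trans ?_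
    rw [Finset.sum_const, nsmul_eq_mul]
  have hsub : {ω : EdgeIdx n → Bool | ∃ v, K ≤ (cl ω Finset.univ v).card ∧
      (cl ω Finset.univ v).card < n} ⊆ ⋃ k ∈ Finset.Ico K n,
        ⋃ C ∈ Finset.powersetCard k Finset.univ, X C ∩ {ω | TripleClosed ω C} := by
    rintro ω ⟨v, h1, h2⟩
    refine Set.mem_iUnion₂.2 ⟨_, Finset.mem_Ico.2 ⟨h1, h2⟩, Set.mem_iUnion₂.2
      ⟨cl ω Finset.univ v, by simp, Set.mem_iUnion₂.2 ⟨v, self_mem_cl, cl_cl⟩,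
        tripleClosed_cl ω v⟩⟩
  refine (measureReal_mono hsub (measure_ne_top _ _)).trans
    ((measureReal_biUnion_finset_le _ _).trans (Finset.sum_le_sum fun k _ => ?_))
  refine (measureReal_biUnion_finset_le _ _).trans ?_
  refine (Finset.sum_le_card_nsmul _ _ _ fun C hC => ?_).trans (by
    rw [Finset.card_powersetCard, Finset.card_univ, Fintype.card_fin, nsmul_eq_mul])
  rw [prodBern_inter hp (hXd C) (determinedBy_tripleClosed C)
    (Set.disjoint_left.2 fun e he he' => he' he)]
  have hk : C.card = k := (Finset.mem_powersetCard.1 hC).2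
  have h1 := hX C
  have h3 := prodBern_tripleClosed_le h₂ h₃ C
  rw [hk] at h1 h3
  exact mul_le_mul h1 h3 measureReal_nonneg (measureReal_nonneg.trans h1)

end Spanning

section Attempts

variable {n : ℕ} {p : EdgeIdx n → ℝ}

lemma determinedBy_cl_eq_of_meets (U C : Finset (Fin n)) (v : Fin n) :
    DeterminedBy {ω : EdgeIdx n → Bool | cl ω U v = C} {e | ¬ Disjoint e.1 C} := by
  intro ω ω' h hω
  rw [Set.mem_ofPred_eq] at hω
  refine (cl_congr fun e he => ?_).trans hω
  exact exists_congr fun h' => by rw [h ⟨e, h'⟩ (by rw [hω] at he; exact he)]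

lemma determinedBy_cl_card_lt (U : Finset (Fin n)) (K : ℕ) :
    DeterminedBy {ω : EdgeIdx n → Bool | ∀ v ∈ U, (cl ω U v).card < K} {e | e.1 ⊆ U} := by
  intro ω ω' h hω v hv
  rw [cl_congr_of_subset (ω := ω) fun e he => exists_congr fun h' => by rw [h ⟨e, h'⟩ he]]
  exact hω v hv

/-- If propagation inside any large vertex set reaches `K` vertices with probability at least `s`,
then `T` consecutive attempts, each in the complement of the preceding ones, all fail with
probability at most `(1 - s) ^ T`. -/
lemma prodBern_all_cl_card_lt_le (hp : ∀ e, 0 ≤ p e ∧ p e ≤ 1) {s : ℝ} {K N : ℕ} (hN : 1 ≤ N)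
    (hs : ∀ U : Finset (Fin n), N ≤ U.card → ∀ v ∈ U,
      s ≤ (prodBern p).real {ω | K ≤ (cl ω U v).card}) (T : ℕ) :
    ∀ U : Finset (Fin n), N + T * K ≤ U.card →
      (prodBern p).real {ω | ∀ v ∈ U, (cl ω U v).card < K} ≤ (1 - s) ^ T := by
  classical
  have := isProbabilityMeasure_prodBern hp
  induction T with
  | zero =>
    intro U _
    simp
  | succ T ih =>
    intro U hU
    have hU' : N + T * K + K ≤ U.card := by rw [add_mul] at hU; omega
    obtain ⟨v, hv⟩ : U.Nonempty := Finset.card_pos.1 (by omega)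
    have hs1 : 0 ≤ 1 - s := by
      have := (hs U (by omega) v hv).trans measureReal_le_one
      linarith
    let F := U.powerset.filter fun C => C.card < K
    let Y : Finset (Fin n) → Set (EdgeIdx n → Bool) := fun C => {ω | cl ω U v = C}
    have hsub : {ω : EdgeIdx n → Bool | ∀ v ∈ U, (cl ω U v).card < K} ⊆
        ⋃ C ∈ F, Y C ∩ {ω | ∀ v ∈ U \ C, (cl ω (U \ C) v).card < K} := by
      intro ω hω
      refine Set.mem_iUnion₂.2 ⟨cl ω U v, ?_, rfl, fun u hu => ?_⟩
      · simp [F, cl_subset hv, hω v hv]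
      · exact (Finset.card_le_card (cl_mono Finset.sdiff_subset)).trans_lt
          (hω u (Finset.mem_sdiff.1 hu).1)
    have hF : ∑ C ∈ F, (prodBern p).real (Y C) ≤ 1 - s := by
      rw [← measureReal_biUnion_finset]
      · have hle : (⋃ C ∈ F, Y C) ⊆ {ω | K ≤ (cl ω U v).card}ᶜ := by
          intro ω hω
          obtain ⟨C, hC, hω⟩ := Set.mem_iUnion₂.1 hω
          rw [Set.mem_compl_iff, Set.mem_ofPred_eq, not_le, show cl ω U v = C from hω]
          exact (Finset.mem_filter.1 hC).2
        refine (measureReal_mono hle (measure_ne_top _ _)).trans ?_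
        rw [probReal_compl_eq_one_sub MeasurableSet.of_discrete]
        linarith [hs U (by omega) v hv]
      · intro C _ C' _ hne
        exact Set.disjoint_left.2 fun ω h h' => hne (h.symm.trans h')
      · exact fun _ _ => MeasurableSet.of_discrete
    calc _ ≤ ∑ C ∈ F, (prodBern p).real
            (Y C ∩ {ω | ∀ v ∈ U \ C, (cl ω (U \ C) v).card < K}) :=
          (measureReal_mono hsub (measure_ne_top _ _)).trans (measureReal_biUnion_finset_le _ _)
      _ ≤ ∑ C ∈ F, (prodBern p).real (Y C) * (1 - s) ^ T := by
          refine Finset.sum_le_sum fun C hC => ?_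
          rw [prodBern_inter hp (determinedBy_cl_eq_of_meets U C v)
            (determinedBy_cl_card_lt (U \ C) K)]
          · refine mul_le_mul_of_nonneg_left (ih _ ?_) measureReal_nonneg
            have h1 := (Finset.mem_filter.1 hC).2
            have h2 := Finset.le_card_sdiff C U
            omega
          · refine Set.disjoint_left.2 fun e he he' => he ?_
            exact Finset.disjoint_of_subset_left he' Finset.sdiff_disjoint
      _ ≤ (1 - s) ^ (T + 1) := by
          rw [← Finset.sum_mul, pow_succ, mul_comm]
          exact mul_le_mul_of_nonneg_left hF (pow_nonneg hs1 _)

end Attempts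

section Exploration

variable {n : ℕ} {p₂ p₃ : ℝ} {ω : EdgeIdx n → Bool} {P A R : Finset (Fin n)} {w : Fin n}

open Classical in
/-- The edges that attach `w` to the vertices of `A`, possibly with the help of a vertex of `P`. -/
noncomputable def attachEdges (P A : Finset (Fin n)) (w : Fin n) : Finset (EdgeIdx n) :=
  Finset.univ.filter fun e => ∃ a ∈ A, e.1 = {w, a} ∨ ∃ b ∈ P, e.1 = {w, a, b}

open Classical in
/-- The vertices of `R` that are attached to `A`. -/
noncomputable def attached (ω : EdgeIdx n → Bool) (P A R : Finset (Fin n)) : Finset (Fin n) :=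
  R.filter fun w => ∃ e ∈ attachEdges P A w, ω e = true

lemma attached_subset : attached ω P A R ⊆ R := Finset.filter_subset _ _

lemma mem_attachEdges {e : EdgeIdx n} :
    e ∈ attachEdges P A w ↔ ∃ a ∈ A, e.1 = {w, a} ∨ ∃ b ∈ P, e.1 = {w, a, b} := by
  simp [attachEdges]

lemma mem_of_mem_attachEdges {e : EdgeIdx n} (he : e ∈ attachEdges P A w) : w ∈ e.1 := by
  obtain ⟨a, -, h | ⟨b, -, h⟩⟩ := mem_attachEdges.1 he <;> simp [h]

lemma mem_union_of_mem_attachEdges {e : EdgeIdx n} (he : e ∈ attachEdges P A w) {u : Fin n}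
    (hu : u ∈ e.1) (huw : u ≠ w) : u ∈ P ∪ A := by
  obtain ⟨a, ha, h | ⟨b, hb, h⟩⟩ := mem_attachEdges.1 he
  · rw [h] at hu
    simp only [Finset.mem_insert, Finset.mem_singleton, huw, false_or] at hu
    exact Finset.mem_union_right _ (hu ▸ ha)
  · rw [h] at hu
    simp only [Finset.mem_insert, Finset.mem_singleton, huw, false_or] at hu
    rcases hu with rfl | rfl
    · exact Finset.mem_union_right _ ha
    · exact Finset.mem_union_left _ hb

lemma attached_subset_cl {U : Finset (Fin n)} {v : Fin n} (hPA : P ∪ A ⊆ cl ω U v)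
    (hv : v ∈ U) (hR : R ⊆ U) : attached ω P A R ⊆ cl ω U v := by
  intro w hw
  obtain ⟨hwR, e, he, hω⟩ := Finset.mem_filter.1 hw
  refine cl_closed ⟨e.2, hω⟩ (fun u hu => ?_) (mem_of_mem_attachEdges he) (fun u hu => ?_)
  · by_cases huw : u = w
    · exact huw ▸ hR hwR
    · exact cl_subset hv (hPA (mem_union_of_mem_attachEdges he hu huw))
  · exact hPA (mem_union_of_mem_attachEdges he (Finset.mem_of_mem_erase hu)
      (Finset.ne_of_mem_erase hu))

lemma sum_attachEdges (hPA : Disjoint P A) (hPw : w ∉ P) (hAw : w ∉ A) :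
    ∑ e ∈ attachEdges P A w, edgeProb n p₂ p₃ e = A.card * p₂ + A.card * P.card * p₃ := by
  classical
  have hwa : ∀ a ∈ A, w ≠ a := fun a ha h => hAw (h ▸ ha)
  have hwb : ∀ b ∈ P, w ≠ b := fun b hb h => hPw (h ▸ hb)
  have hab : ∀ a ∈ A, ∀ b ∈ P, a ≠ b := fun a ha b hb h =>
    Finset.disjoint_left.1 hPA hb (h ▸ ha)
  have h2 : ∀ a ∈ A, ({w, a} : Finset (Fin n)).card = 2 := fun a ha =>
    Finset.card_pair (hwa a ha)
  have h3 : ∀ a ∈ A, ∀ b ∈ P, ({w, a, b} : Finset (Fin n)).card = 3 := fun a ha b hb =>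
    Finset.card_eq_three.2 ⟨w, a, b, hwa a ha, hwb b hb, hab a ha b hb, rfl⟩
  have c2 : A.card = ((attachEdges P A w).filter (fun e => e.1.card = 2)).card := by
    refine Finset.card_bij (fun a ha => ⟨{w, a}, Or.inl (h2 a ha)⟩) ?_ ?_ ?_
    · intro a ha
      rw [Finset.mem_filter]
      exact ⟨mem_attachEdges.2 ⟨a, ha, Or.inl rfl⟩, h2 a ha⟩
    · intro a ha a' ha' h
      have h' : ({w, a} : Finset (Fin n)) = {w, a'} := congrArg Subtype.val h
      have : a ∈ ({w, a'} : Finset (Fin n)) := h' ▸ by simp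
      simpa [(hwa a ha).symm] using this
    · intro e he
      obtain ⟨he, hc⟩ := Finset.mem_filter.1 he
      obtain ⟨a, ha, h | ⟨b, hb, h⟩⟩ := mem_attachEdges.1 he
      · exact ⟨a, ha, Subtype.ext h.symm⟩
      · rw [h, h3 a ha b hb] at hc
        omega
  have c3 : (A ×ˢ P).card = ((attachEdges P A w).filter (fun e => ¬ e.1.card = 2)).card := by
    refine Finset.card_bij (fun x hx => ⟨{w, x.1, x.2}, Or.inr
      (h3 x.1 (Finset.mem_product.1 hx).1 x.2 (Finset.mem_product.1 hx).2)⟩) ?_ ?_ ?_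
    · intro x hx
      obtain ⟨ha, hb⟩ := Finset.mem_product.1 hx
      rw [Finset.mem_filter]
      refine ⟨mem_attachEdges.2 ⟨x.1, ha, Or.inr ⟨x.2, hb, rfl⟩⟩, ?_⟩
      rw [h3 _ ha _ hb]
      omega
    · rintro ⟨a, b⟩ hx ⟨a', b'⟩ hx' h
      obtain ⟨ha, hb⟩ := Finset.mem_product.1 hx
      obtain ⟨ha', hb'⟩ := Finset.mem_product.1 hx'
      simp only at ha hb ha' hb'
      have h' : ({w, a, b} : Finset (Fin n)) = {w, a', b'} := congrArg Subtype.val h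
      have e1 : a ∈ ({w, a', b'} : Finset (Fin n)) := h' ▸ by simp
      have e2 : b ∈ ({w, a', b'} : Finset (Fin n)) := h' ▸ by simp
      simp only [Finset.mem_insert, Finset.mem_singleton, (hwa a ha).symm, hab a ha b' hb',
        (hwb b hb).symm, (hab a' ha' b hb).symm, false_or, or_false] at e1 e2
      rw [e1, e2]
    · intro e he
      obtain ⟨he, hc⟩ := Finset.mem_filter.1 he
      obtain ⟨a, ha, h | ⟨b, hb, h⟩⟩ := mem_attachEdges.1 he
      · rw [h, h2 a ha] at hc
        omega
      · exact ⟨(a, b), Finset.mem_product.2 ⟨ha, hb⟩, Subtype.ext h.symm⟩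
  rw [← Finset.sum_filter_add_sum_filter_not _ (fun e : EdgeIdx n => e.1.card = 2)]
  congr 1
  · rw [Finset.sum_congr rfl (g := fun _ => p₂) (by
      intro e he
      rw [Finset.mem_filter] at he
      simp [edgeProb, he.2]), Finset.sum_const, nsmul_eq_mul, ← c2]
  · rw [Finset.sum_congr rfl (g := fun _ => p₃) (by
      intro e he
      rw [Finset.mem_filter] at he
      simp [edgeProb, he.2]), Finset.sum_const, nsmul_eq_mul, ← c3, Finset.card_product]
    push_cast
    ring

lemma one_sub_sum_le_prod {ι : Type*} (s : Finset ι) (f : ι → ℝ)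
    (hf : ∀ i ∈ s, 0 ≤ f i ∧ f i ≤ 1) : 1 - ∑ i ∈ s, f i ≤ ∏ i ∈ s, (1 - f i) := by
  classical
  induction s using Finset.induction_on with
  | empty => simp
  | insert a s ha ih =>
    have h := ih fun i hi => hf i (Finset.mem_insert_of_mem hi)
    obtain ⟨h0, h1⟩ := hf a (Finset.mem_insert_self _ _)
    have hs : 0 ≤ ∑ i ∈ s, f i :=
      Finset.sum_nonneg fun i hi => (hf i (Finset.mem_insert_of_mem hi)).1
    rw [Finset.sum_insert ha, Finset.prod_insert ha]
    nlinarith [mul_le_mul_of_nonneg_left h (sub_nonneg.2 h1), mul_nonneg h0 hs]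

/-- Lower bound for the probability that exactly `B` vertices of `R` are attached to `A` and that
they have a further property that depends only on disjoint sets of edges. -/
lemma le_prodBern_attached (h₂ : 0 ≤ p₂ ∧ p₂ ≤ 1) (h₃ : 0 ≤ p₃ ∧ p₃ ≤ 1) (hPA : Disjoint P A)
    (hPR : Disjoint P R) (hAR : Disjoint A R) {σ t : ℝ} {B : ℕ}
    (hσ : σ = A.card * p₂ + A.card * P.card * p₃) (hσ1 : σ ≤ 1) (ht : 0 ≤ t)
    (X : Finset (Fin n) → Set (EdgeIdx n → Bool))
    (hX : ∀ S ⊆ R, S.card = B →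
      DeterminedBy (X S) {e | 2 ≤ (e.1 ∩ R).card} ∧ t ≤ (prodBern (edgeProb n p₂ p₃)).real (X S)) :
    R.card.choose B * σ ^ B * (1 - σ) ^ R.card * t ≤ (prodBern (edgeProb n p₂ p₃)).real
      {ω | (attached ω P A R).card = B ∧ ω ∈ X (attached ω P A R)} := by
  classical
  have hp := edgeProb_mem (n := n) h₂ h₃
  have := isProbabilityMeasure_prodBern hp
  set μ := prodBern (edgeProb n p₂ p₃) with hμ
  have hσ0 : 0 ≤ σ := by
    have := h₂.1; have := h₃.1; rw [hσ]; positivity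
  let Y : Finset (Fin n) → Set (EdgeIdx n → Bool) := fun S => {ω | attached ω P A R = S}
  let N : Fin n → Set (EdgeIdx n → Bool) := fun w => {ω | ∀ e ∈ attachEdges P A w, ω e = false}
  let Z : Finset (Fin n) → Fin n → Set (EdgeIdx n → Bool) :=
    fun S w => if w ∈ S then (N w)ᶜ else N w
  have hZd : ∀ S w, DeterminedBy (Z S w) (attachEdges P A w : Set (EdgeIdx n)) := by
    intro S w
    simp only [Z]
    split_ifs
    · exact (determinedBy_all _ _).compl
    · exact determinedBy_all _ _
  have hYZ : ∀ S ⊆ R, Y S = {ω | ∀ w ∈ R, ω ∈ Z S w} := by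
    intro S hS
    ext ω
    have hN : ∀ w, ω ∈ (N w)ᶜ ↔ ∃ e ∈ attachEdges P A w, ω e = true := by
      intro w
      simp [N]
    simp only [Y, Set.mem_ofPred_eq, Finset.ext_iff, attached, Finset.mem_filter, Z]
    refine forall_congr' fun w => ?_
    rw [← hN w]
    by_cases hw : w ∈ S
    · simp [hw, hS hw]
    · by_cases hwR : w ∈ R <;> simp [hw, hwR]
  have hinter : ∀ w ∈ R, ∀ e ∈ attachEdges P A w, e.1 ∩ R = {w} := by
    intro w hw e he
    ext u
    simp only [Finset.mem_inter, Finset.mem_singleton]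
    constructor
    · rintro ⟨hu, huR⟩
      by_contra huw
      rcases Finset.mem_union.1 (mem_union_of_mem_attachEdges he hu huw) with h | h
      · exact Finset.disjoint_left.1 hPR h huR
      · exact Finset.disjoint_left.1 hAR h huR
    · rintro rfl
      exact ⟨mem_of_mem_attachEdges he, hw⟩
  have hdisj : (R : Set (Fin n)).PairwiseDisjoint
      fun w => (attachEdges P A w : Set (EdgeIdx n)) := by
    intro w hw u hu hwu
    refine Set.disjoint_left.2 fun e he he' => hwu ?_
    have h1 := hinter w hw e he
    rw [hinter u hu e he'] at h1
    simpa using h1.symm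
  have hNμ : ∀ w ∈ R, 1 - σ ≤ μ.real (N w) ∧ σ * (1 - σ) ≤ μ.real (N w)ᶜ := by
    intro w hw
    have hs : ∑ e ∈ attachEdges P A w, edgeProb n p₂ p₃ e = σ := by
      rw [hσ, sum_attachEdges hPA (fun h => Finset.disjoint_left.1 hPR h hw)
        (fun h => Finset.disjoint_left.1 hAR h hw)]
    have hN : μ.real (N w) = ∏ e ∈ attachEdges P A w, (1 - edgeProb n p₂ p₃ e) :=
      prodBern_all_false hp _
    constructor
    · rw [hN, ← hs]
      exact one_sub_sum_le_prod _ _ fun e _ => hp e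
    · rw [probReal_compl_eq_one_sub MeasurableSet.of_discrete, hN]
      have h1 : ∏ e ∈ attachEdges P A w, (1 - edgeProb n p₂ p₃ e) ≤ Real.exp (-σ) := by
        rw [← hs, ← Finset.sum_neg_distrib, Real.exp_sum]
        refine Finset.prod_le_prod (fun e _ => sub_nonneg.2 (hp e).2) fun e _ => ?_
        linarith [Real.add_one_le_exp (-edgeProb n p₂ p₃ e)]
      have h2 := abs_le.1 (Real.abs_exp_sub_one_sub_id_le (x := -σ)
        (by rw [abs_neg, abs_of_nonneg hσ0]; exact hσ1))
      nlinarith [h2.2]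
  have hYd : ∀ S ⊆ R, DeterminedBy (Y S) {e | ¬ 2 ≤ (e.1 ∩ R).card} := by
    intro S hS ω ω' h hω
    rw [hYZ S hS] at hω ⊢
    intro w hw
    refine hZd S w ω ω' (fun e he => h e ?_) (hω w hw)
    rw [Set.mem_ofPred_eq, hinter w hw e he]
    simp
  have hY : ∀ S ⊆ R, S.card = B → σ ^ B * (1 - σ) ^ R.card ≤ μ.real (Y S) := by
    intro S hS hSB
    rw [hYZ S hS, prodBern_biInter hp R (Z S) _ (fun w _ => hZd S w) hdisj]
    calc σ ^ B * (1 - σ) ^ R.card = ∏ w ∈ R, if w ∈ S then σ * (1 - σ) else 1 - σ := by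
          have : ∀ w, (if w ∈ S then σ * (1 - σ) else 1 - σ)
              = (if w ∈ S then σ else 1) * (1 - σ) := by
            intro w; split_ifs <;> ring
          simp only [this]
          rw [Finset.prod_mul_distrib, Finset.prod_const, Finset.prod_ite_mem,
            Finset.inter_eq_right.2 hS, Finset.prod_const, hSB]
      _ ≤ ∏ w ∈ R, μ.real (Z S w) := by
          refine Finset.prod_le_prod (fun w _ => ?_) fun w hw => ?_
          · have := sub_nonneg.2 hσ1
            split_ifs <;> positivity
          · simp only [Z]
            split_ifs
            exacts [(hNμ w hw).2, (hNμ w hw).1]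
  calc R.card.choose B * σ ^ B * (1 - σ) ^ R.card * t
      = ∑ S ∈ R.powersetCard B, σ ^ B * (1 - σ) ^ R.card * t := by
        rw [Finset.sum_const, Finset.card_powersetCard, nsmul_eq_mul]
        ring
    _ ≤ ∑ S ∈ R.powersetCard B, μ.real (Y S ∩ X S) := by
        refine Finset.sum_le_sum fun S hS => ?_
        obtain ⟨hS, hSB⟩ := Finset.mem_powersetCard.1 hS
        rw [prodBern_inter hp (hYd S hS) (hX S hS hSB).1
          (Set.disjoint_left.2 fun e he he' => he he')]
        exact mul_le_mul (hY S hS hSB) (hX S hS hSB).2 ht measureReal_nonneg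
    _ = μ.real (⋃ S ∈ R.powersetCard B, Y S ∩ X S) := by
        rw [measureReal_biUnion_finset _ fun _ _ => MeasurableSet.of_discrete]
        intro S _ S' _ hne
        exact Set.disjoint_left.2 fun ω h h' => hne (h.1.symm.trans h'.1)
    _ ≤ _ := by
        refine measureReal_mono ?_ (measure_ne_top _ _)
        intro ω hω
        obtain ⟨S, hS, hY, hX⟩ := Set.mem_iUnion₂.1 hω
        obtain rfl : attached ω P A R = S := hY
        exact ⟨(Finset.mem_powersetCard.1 hS).2, hX⟩

/-- `i` consecutive exploration rounds, each of which attaches exactly `B` new vertices. The set of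
processed vertices is kept at size at most `M`. -/
def Rounds (ω : EdgeIdx n → Bool) (B M : ℕ) : ℕ → (P A R : Finset (Fin n)) → Prop
  | 0, _, _, _ => True
  | i + 1, P, A, R => (attached ω P A R).card = B ∧
      Rounds ω B M i (if P.card + B ≤ M then P ∪ A else P) (attached ω P A R)
        (R \ attached ω P A R)

lemma attached_congr {ω ω' : EdgeIdx n → Bool}
    (h : ∀ w ∈ R, ∀ e ∈ attachEdges P A w, ω e = ω' e) :
    attached ω P A R = attached ω' P A R := by
  classical
  refine Finset.filter_congr fun w hw => ?_
  exact exists_congr fun e => and_congr_right fun he => by rw [h w hw e he]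

lemma determinedBy_rounds (B M i : ℕ) : ∀ P A R : Finset (Fin n), Disjoint A R →
    DeterminedBy {ω | Rounds ω B M i P A R} {e | 2 ≤ (e.1 ∩ (A ∪ R)).card} := by
  induction i with
  | zero => intro P A R _ ω ω' _ _; trivial
  | succ i ih =>
    intro P A R hAR ω ω' h hω
    have hatt : attached ω P A R = attached ω' P A R := by
      refine attached_congr fun w hw e he => h e ?_
      have hwe := mem_of_mem_attachEdges he
      obtain ⟨a, ha, hea⟩ := mem_attachEdges.1 he
      have hae : a ∈ e.1 := by
        rcases hea with h | ⟨b, -, h⟩ <;> simp [h]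
      have hne : w ≠ a := fun h => Finset.disjoint_left.1 hAR ha (h ▸ hw)
      refine (Finset.card_pair hne).ge.trans (Finset.card_le_card ?_)
      rw [Finset.insert_subset_iff, Finset.singleton_subset_iff]
      simp [hwe, hw, ha, hae]
    obtain ⟨h1, h2⟩ := hω
    rw [hatt] at h1 h2
    refine ⟨h1, ih _ _ _ Finset.disjoint_sdiff ω ω' (fun e he => h e ?_) h2⟩
    rw [Set.mem_ofPred_eq, Finset.union_sdiff_of_subset attached_subset] at he
    exact le_trans he (Finset.card_le_card
      (Finset.inter_subset_inter_left Finset.subset_union_right))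

lemma Rounds.mul_le_card {U : Finset (Fin n)} {v : Fin n} (hv : v ∈ U) {B M i : ℕ} :
    ∀ {P A R : Finset (Fin n)}, Rounds ω B M i P A R → P ∪ A ⊆ cl ω U v → R ⊆ U →
      i * B ≤ (cl ω U v ∩ R).card := by
  induction i with
  | zero => intros; simp
  | succ i ih =>
    intro P A R h hPA hR
    obtain ⟨h1, h2⟩ := h
    have hatt := attached_subset_cl hPA hv hR
    have := ih h2 (by
      refine Finset.union_subset ?_ hatt
      split_ifs
      · exact hPA
      · exact Finset.subset_union_left.trans hPA) (Finset.sdiff_subset.trans hR)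
    have hle : (attached ω P A R).card + (cl ω U v ∩ (R \ attached ω P A R)).card
        ≤ (cl ω U v ∩ R).card := by
      rw [← Finset.card_union_of_disjoint]
      · refine Finset.card_le_card (Finset.union_subset ?_ ?_)
        · exact Finset.subset_inter hatt attached_subset
        · exact Finset.inter_subset_inter_left Finset.sdiff_subset
      · exact Finset.disjoint_of_subset_right Finset.inter_subset_right Finset.disjoint_sdiff
    rw [add_mul]
    omega

/-- A recursive lower bound for the probability of completing `i` exploration rounds. -/
lemma le_prodBern_rounds (h₂ : 0 ≤ p₂ ∧ p₂ ≤ 1) (h₃ : 0 ≤ p₃ ∧ p₃ ≤ 1) {B M N : ℕ}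
    (L : ℕ → ℕ → ℝ) (hL0 : ∀ y ≤ M, L 0 y ≤ 1) (hLnn : ∀ i y, 0 ≤ L i y)
    (hσ1 : ∀ y ≤ M, B * p₂ + B * y * p₃ ≤ 1)
    (hL : ∀ i, ∀ y ≤ M, L (i + 1) y ≤ N.choose B * (B * p₂ + B * y * p₃) ^ B *
      (1 - (B * p₂ + B * y * p₃)) ^ n * L i (if y + B ≤ M then y + B else y)) (i : ℕ) :
    ∀ P A R : Finset (Fin n), Disjoint P A → Disjoint P R → Disjoint A R → A.card = B →
      P.card ≤ M → N + i * B ≤ R.card →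
      L i P.card ≤ (prodBern (edgeProb n p₂ p₃)).real {ω | Rounds ω B M i P A R} := by
  have := isProbabilityMeasure_prodBern (edgeProb_mem (n := n) h₂ h₃)
  induction i with
  | zero =>
    intro P A R _ _ _ _ hP _
    simpa [Rounds] using hL0 _ hP
  | succ i ih =>
    intro P A R hPA hPR hAR hA hP hR
    rw [add_mul] at hR
    set P' := if P.card + B ≤ M then P ∪ A else P with hP'
    have hc : P'.card = if P.card + B ≤ M then P.card + B else P.card := by
      rw [hP']
      split_ifs
      · rw [Finset.card_union_of_disjoint hPA, hA]
      · rfl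
    have hP'R : Disjoint P' R := by
      rw [hP']
      split_ifs
      · exact Finset.disjoint_union_left.2 ⟨hPR, hAR⟩
      · exact hPR
    set σ := A.card * p₂ + A.card * P.card * p₃ with hσ
    have hσ1' : σ ≤ 1 := by rw [hσ, hA]; exact hσ1 _ hP
    have hσ0 : 0 ≤ σ := by
      have := h₂.1; have := h₃.1; rw [hσ]; positivity
    have key := le_prodBern_attached h₂ h₃ hPA hPR hAR (B := B) hσ hσ1' (hLnn i P'.card)
      (fun S => {ω | Rounds ω B M i P' S (R \ S)}) (fun S hS hSB => ⟨?_, ?_⟩)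
    · refine ((hL i P.card hP).trans ?_).trans key
      rw [← hc, hσ, hA]
      rw [hσ, hA] at hσ1' hσ0
      have h0 := hLnn i P'.card
      have h1 := sub_nonneg.2 hσ1'
      have h2 : N.choose B ≤ R.card.choose B := Nat.choose_le_choose B (by omega)
      have h3 : R.card ≤ n := by simpa using R.card_le_univ
      have h4 := pow_le_pow_of_le_one h1 (by linarith) h3
      gcongr
    · refine (determinedBy_rounds B M i P' S (R \ S) Finset.disjoint_sdiff).mono ?_
      rw [Finset.union_sdiff_of_subset hS]
    · refine ih P' S (R \ S) (Finset.disjoint_of_subset_right hS hP'R)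
        (Finset.disjoint_of_subset_right Finset.sdiff_subset hP'R) Finset.disjoint_sdiff hSB ?_ ?_
      · rw [hc]; split_ifs <;> omega
      · have := Finset.le_card_sdiff S R
        omega

lemma le_prodBern_cl_card (h₂ : 0 ≤ p₂ ∧ p₂ ≤ 1) (h₃ : 0 ≤ p₃ ∧ p₃ ≤ 1) {B M N K m : ℕ}
    (L : ℕ → ℕ → ℝ) (hL0 : ∀ y ≤ M, L 0 y ≤ 1) (hLnn : ∀ i y, 0 ≤ L i y)
    (hσ1 : ∀ y ≤ M, B * p₂ + B * y * p₃ ≤ 1)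
    (hL : ∀ i, ∀ y ≤ M, L (i + 1) y ≤ N.choose B * (B * p₂ + B * y * p₃) ^ B *
      (1 - (B * p₂ + B * y * p₃)) ^ n * L i (if y + B ≤ M then y + B else y))
    (hK : K ≤ m * B) (U : Finset (Fin n)) (hU : N + (m + 1) * B + 1 ≤ U.card) (v : Fin n)
    (hv : v ∈ U) :
    N.choose B * p₂ ^ B * (1 - p₂) ^ n * L m 0 ≤
      (prodBern (edgeProb n p₂ p₃)).real {ω | K ≤ (cl ω U v).card} := by
  have := isProbabilityMeasure_prodBern (edgeProb_mem (n := n) h₂ h₃)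
  set R := U.erase v with hR
  have hRc : R.card = U.card - 1 := Finset.card_erase_of_mem hv
  rw [add_mul, one_mul] at hU
  have key := le_prodBern_attached h₂ h₃ (P := ∅) (A := {v}) (R := R) (B := B) (σ := p₂)
    (t := L m 0) (by simp) (by simp) (by simp [hR]) (by simp) h₂.2 (hLnn m 0)
    (fun S => {ω | Rounds ω B M m ∅ S (R \ S)}) (fun S hS hSB => ⟨?_, ?_⟩)
  · have h1 := sub_nonneg.2 h₂.2
    have h0 := h₂.1
    have hl := hLnn m 0
    have h2 : N.choose B ≤ R.card.choose B := Nat.choose_le_choose B (by omega)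
    have h3 : R.card ≤ n := by simpa using R.card_le_univ
    have h4 := pow_le_pow_of_le_one h1 (by linarith) h3
    refine le_trans ?_ (key.trans (measureReal_mono ?_ (measure_ne_top _ _)))
    · gcongr
    · rintro ω ⟨-, hω⟩
      have hRU : R ⊆ U := Finset.erase_subset _ _
      have hatt : attached ω ∅ {v} R ⊆ cl ω U v :=
        attached_subset_cl (by simp [Reach.base]) hv hRU
      refine hK.trans ((Rounds.mul_le_card hv hω ?_ (Finset.sdiff_subset.trans hRU)).trans
        (Finset.card_le_card Finset.inter_subset_left))
      simpa using hatt
  · refine (determinedBy_rounds B M m ∅ S (R \ S) Finset.disjoint_sdiff).mono ?_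
    rw [Finset.union_sdiff_of_subset hS]
  · have := le_prodBern_rounds h₂ h₃ (N := N) L hL0 hLnn hσ1 hL m ∅ S (R \ S) (by simp) (by simp)
      Finset.disjoint_sdiff hSB (by simp) (by
        have := Finset.le_card_sdiff S R
        omega)
    simpa using this

end Exploration

section Analysis

lemma one_add_le_exp_div_four_sub_two {x : ℝ} (hx : 32 ≤ x) : 1 + x ≤ Real.exp (x / 4 - 2) := by
  have h6 : (33 : ℝ) ≤ Real.exp 6 := by
    have h1 : (2.7 : ℝ) ≤ Real.exp 1 := by linarith [Real.exp_one_gt_d9]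
    have h2 : Real.exp 6 = Real.exp 1 ^ 6 := by rw [← Real.exp_nat_mul]; norm_num
    rw [h2]
    calc (33 : ℝ) ≤ 2.7 ^ 6 := by norm_num
      _ ≤ _ := by gcongr
  have h : x / 4 - 2 = 6 + (x - 32) / 4 := by ring
  rw [h, Real.exp_add]
  have h2 := Real.add_one_le_exp ((x - 32) / 4)
  nlinarith

lemma choose_le_div_pow_mul_exp (n : ℕ) {k : ℕ} (hk : 0 < k) :
    (n.choose k : ℝ) ≤ (n / k : ℝ) ^ k * Real.exp k := by
  have hk' : (0 : ℝ) < k := by exact_mod_cast hk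
  have h1 := Nat.choose_le_pow_div (α := ℝ) k n
  have h2 := Real.pow_div_factorial_le_exp (k : ℝ) hk'.le k
  calc (n.choose k : ℝ) ≤ n ^ k / k.factorial := h1
    _ = (n / k : ℝ) ^ k * (k ^ k / k.factorial) := by
        rw [div_pow]
        field_simp
    _ ≤ _ := by gcongr

/-- The summand of the union bound over closures of size `k` with `2 * k ≤ n`. -/
lemma union_bound_small {n k : ℕ} {r p₂ p₃ κ : ℝ} (hr : 0 < r) (hn : 3 ≤ n)
    (hp₂ : 0 ≤ p₂) (hp₂' : p₂ ≤ 1 / n) (hp₃ : p₃ = r / (n * Real.log n)) (hκ : 4 ≤ κ)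
    (hκr : 64 ≤ κ * r) (hL : 1 ≤ Real.log n) (hk : κ * Real.log n ≤ k) (hkn : 2 * k ≤ n) :
    n.choose k * (k * (k * p₂ + (k : ℝ) ^ 2 / 2 * p₃) ^ (k - 1) *
      Real.exp (-((n - k : ℝ) * (k.choose 2) * p₃))) ≤ Real.exp (-(3 * Real.log n)) := by
  set L := Real.log n with hLdef
  have hn0 : (0 : ℝ) < n := by positivity
  have hL0 : 0 < L := by linarith
  have hk4 : 4 * L ≤ k := le_trans (by nlinarith) hk
  have hk0 : (0 : ℝ) < k := by linarith
  have hkpos : 0 < k := by exact_mod_cast hk0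
  have hk2 : (2 : ℝ) ≤ k := by linarith
  set x := r * k / (2 * L) with hx
  have hx32 : 32 ≤ x := by
    rw [hx, le_div_iff₀ (by positivity)]
    nlinarith [mul_le_mul_of_nonneg_left hk hr.le]
  have hD : (k * p₂ + (k : ℝ) ^ 2 / 2 * p₃) ≤ k / n * (1 + x) := by
    have e1 : (k : ℝ) * p₂ ≤ k * (1 / n) := by gcongr
    have e2 : (k : ℝ) ^ 2 / 2 * p₃ = k / n * x := by
      rw [hp₃, hx]; field_simp
    rw [e2]
    calc _ ≤ (k : ℝ) * (1 / n) + k / n * x := by gcongr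
      _ = _ := by ring
  have hp₃0 : 0 ≤ p₃ := by rw [hp₃]; positivity
  have hD0 : 0 ≤ (k * p₂ + (k : ℝ) ^ 2 / 2 * p₃) := by positivity
  have hexp : x * k / 4 ≤ (n - k : ℝ) * (k.choose 2) * p₃ := by
    rw [Nat.cast_choose_two, hp₃, hx]
    have hkn' : (2 : ℝ) * k ≤ n := by exact_mod_cast hkn
    have h1 : (n : ℝ) / 2 * (k * (k / 2) / 2) ≤ (n - k : ℝ) * (k * (k - 1) / 2) := by
      have h2 : (n : ℝ) / 2 ≤ n - k := by linarith
      have h3 : (k : ℝ) * (k / 2) / 2 ≤ k * (k - 1) / 2 := by nlinarith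
      exact mul_le_mul h2 h3 (by positivity) (by linarith)
    calc r * k / (2 * L) * k / 4 = (n : ℝ) / 2 * (k * (k / 2) / 2) * (r / (n * L)) := by
          field_simp; ring
      _ ≤ _ := by gcongr
  have h1x : 0 ≤ 1 + x := by linarith
  calc n.choose k * (k * (k * p₂ + (k : ℝ) ^ 2 / 2 * p₃) ^ (k - 1) *
      Real.exp (-((n - k : ℝ) * (k.choose 2) * p₃)))
      ≤ ((n / k : ℝ) ^ k * Real.exp k) * (k * (k / n * (1 + x)) ^ (k - 1) *
          Real.exp (-(x * k / 4))) := by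
        gcongr
        exact choose_le_div_pow_mul_exp n hkpos
    _ = n * Real.exp k * (1 + x) ^ (k - 1) * Real.exp (-(x * k / 4)) := by
        obtain ⟨j, rfl⟩ : ∃ j, k = j + 1 := ⟨k - 1, by omega⟩
        rw [Nat.add_sub_cancel, mul_pow, div_pow, div_pow, pow_succ, pow_succ]
        field_simp
    _ ≤ n * Real.exp k * (1 + x) ^ k * Real.exp (-(x * k / 4)) := by
        gcongr
        · linarith
        · omega
    _ ≤ n * Real.exp k * Real.exp (x / 4 - 2) ^ k * Real.exp (-(x * k / 4)) := by
        gcongr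
        exact one_add_le_exp_div_four_sub_two hx32
    _ = Real.exp (L - k) := by
        rw [← Real.exp_nat_mul]
        nth_rw 1 [← Real.exp_log hn0]
        rw [← hLdef, ← Real.exp_add, ← Real.exp_add, ← Real.exp_add]
        congr 1
        ring
    _ ≤ _ := by
        apply Real.exp_le_exp.2
        linarith

/-- The summand of the union bound over closures of size `k` with `n < 2 * k`. -/
lemma union_bound_large {n k : ℕ} {r p₃ : ℝ} (hr : 0 < r) (hn : 4 ≤ n)
    (hp₃ : p₃ = r / (n * Real.log n)) (hL : 1 ≤ Real.log n) (hLr : 64 * Real.log n ^ 2 ≤ n * r)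
    (hk : k < n) (hkn : n < 2 * k) :
    n.choose k * Real.exp (-((n - k : ℝ) * (k.choose 2) * p₃)) ≤ Real.exp (-(3 * Real.log n)) := by
  set L := Real.log n with hLdef
  have hn0 : (0 : ℝ) < n := by positivity
  have hn4 : (4 : ℝ) ≤ n := by exact_mod_cast hn
  have hL0 : 0 < L := by linarith
  have hkn' : (n : ℝ) ≤ 2 * k := by exact_mod_cast hkn.le
  have hk' : (1 : ℝ) ≤ n - k := by
    have : (k : ℝ) + 1 ≤ n := by exact_mod_cast hk
    linarith
  have hchoose : (n.choose k : ℝ) ≤ Real.exp (L * (n - k)) := by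
    rw [← Nat.choose_symm hk.le]
    have h1 : n.choose (n - k) ≤ n ^ (n - k) := Nat.choose_le_pow n (n - k)
    calc (n.choose (n - k) : ℝ) ≤ (n : ℝ) ^ (n - k) := by exact_mod_cast h1
      _ = Real.exp L ^ (n - k) := by rw [hLdef, Real.exp_log hn0]
      _ = _ := by
        rw [← Real.exp_nat_mul, Nat.cast_sub hk.le]
        ring_nf
  have hexp : 4 * L * (n - k) ≤ (n - k : ℝ) * (k.choose 2) * p₃ := by
    have h1 : (n : ℝ) ^ 2 / 16 ≤ k.choose 2 := by
      rw [Nat.cast_choose_two]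
      nlinarith
    have h2 : 4 * L ≤ (n : ℝ) ^ 2 / 16 * p₃ := by
      rw [hp₃]
      have : (n : ℝ) ^ 2 / 16 * (r / (n * L)) = n * r / (16 * L) := by field_simp
      rw [this, le_div_iff₀ (by positivity)]
      nlinarith
    have hp₃0 : 0 ≤ p₃ := by rw [hp₃]; positivity
    calc 4 * L * (n - k) ≤ ((n : ℝ) ^ 2 / 16 * p₃) * (n - k) := by gcongr
      _ ≤ ((k.choose 2) * p₃) * (n - k) := by gcongr
      _ = _ := by ring
  calc n.choose k * Real.exp (-((n - k : ℝ) * (k.choose 2) * p₃))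
      ≤ Real.exp (L * (n - k)) * Real.exp (-(4 * L * (n - k))) := by gcongr
    _ = Real.exp (-(3 * L * (n - k))) := by
        rw [← Real.exp_add]
        ring_nf
    _ ≤ _ := by
        apply Real.exp_le_exp.2
        nlinarith

lemma prodBern_exists_cl_le_exp {n K : ℕ} {r p₂ p₃ κ : ℝ} (hr : 0 < r) (hn : 4 ≤ n)
    (hp₂ : 0 ≤ p₂) (hp₂' : p₂ ≤ 1 / n) (hp₃ : p₃ = r / (n * Real.log n)) (hκ : 4 ≤ κ)
    (hκr : 64 ≤ κ * r) (hL : 1 ≤ Real.log n) (hLr : 64 * Real.log n ^ 2 ≤ n * r)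
    (hp₃1 : p₃ ≤ 1) (hK : κ * Real.log n ≤ K) :
    (prodBern (edgeProb n p₂ p₃)).real
      {ω | ∃ v, K ≤ (cl ω Finset.univ v).card ∧ (cl ω Finset.univ v).card < n}
      ≤ Real.exp (-(2 * Real.log n)) := by
  have hn0 : (0 : ℝ) < n := by positivity
  have hp₂1 : p₂ ≤ 1 := hp₂'.trans (by
    rw [div_le_one hn0]
    exact_mod_cast (by omega : 1 ≤ n))
  have hp₃0 : 0 ≤ p₃ := by rw [hp₃]; positivity
  refine (prodBern_exists_cl_le ⟨hp₂, hp₂1⟩ ⟨hp₃0, hp₃1⟩ K).trans ?_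
  calc _ ≤ ∑ k ∈ Finset.Ico K n, Real.exp (-(3 * Real.log n)) := by
        refine Finset.sum_le_sum fun k hk => ?_
        obtain ⟨hKk, hkn⟩ := Finset.mem_Ico.1 hk
        rcases le_or_gt (2 * k) n with h | h
        · refine le_trans ?_ (union_bound_small hr (by omega) hp₂ hp₂' hp₃ hκ hκr hL
            (hK.trans (by exact_mod_cast hKk)) h)
          gcongr
          exact min_le_right _ _
        · refine le_trans ?_ (union_bound_large hr hn hp₃ hL hLr hkn h)
          gcongr
          exact mul_le_of_le_one_left (Real.exp_pos _).le (min_le_left _ _)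
    _ ≤ n * Real.exp (-(3 * Real.log n)) := by
        rw [Finset.sum_const, nsmul_eq_mul, Nat.card_Ico]
        gcongr
        omega
    _ = _ := by
        nth_rw 1 [← Real.exp_log hn0]
        rw [← Real.exp_add]
        ring_nf

end Analysis

section RateFunction

/-- The relative entropy of a Poisson law of mean `1` with respect to one of mean `x`. -/
noncomputable def poissonCost (x : ℝ) : ℝ := x - 1 - Real.log x

/-- An antiderivative of `poissonCost`. -/
noncomputable def costPrimitive (x : ℝ) : ℝ := x ^ 2 / 2 - x * Real.log x

lemma poissonCost_nonneg {x : ℝ} (hx : 0 < x) : 0 ≤ poissonCost x := by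
  unfold poissonCost
  linarith [Real.log_le_sub_one_of_pos hx]

lemma mul_poissonCost_le {a b : ℝ} (ha : 0 < a) (hab : a ≤ b) (hb : b ≤ 1) :
    (b - a) * poissonCost b ≤ costPrimitive b - costPrimitive a := by
  have hb0 : 0 < b := ha.trans_le hab
  have hlog : Real.log (b / a) ≤ (b / a - (b / a)⁻¹) / 2 := by
    rw [← Real.sinh_log (by positivity)]
    exact Real.self_le_sinh_iff.2 (Real.log_nonneg ((one_le_div ha).2 hab))
  have h1 : a * Real.log (b / a) ≤ (b - a) * (1 - (b - a) / 2) := by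
    have h2 : a * ((b / a - (b / a)⁻¹) / 2) = (b - a) * (a + b) / (2 * b) := by
      field_simp
      ring
    have h3 : (b - a) * (a + b) / (2 * b) ≤ (b - a) * (1 - (b - a) / 2) := by
      rw [div_le_iff₀ (by positivity)]
      have : 0 ≤ (b - a) * ((b - a) * (1 - b)) :=
        mul_nonneg (by linarith) (mul_nonneg (by linarith) (by linarith))
      nlinarith
    calc _ ≤ a * ((b / a - (b / a)⁻¹) / 2) := by gcongr
      _ ≤ _ := h2.le.trans h3
  rw [Real.log_div hb0.ne' ha.ne'] at h1
  unfold poissonCost costPrimitive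
  nlinarith

lemma poissonCost_le_of_near_one {x h : ℝ} (hx1 : x ≤ 1) (hh : h ≤ 1 / 2)
    (hx : 1 ≤ x + h) : poissonCost x ≤ 2 * h ^ 2 := by
  have hx0 : 1 / 2 ≤ x := by linarith
  have hlog := Real.log_le_sub_one_of_pos (x := x⁻¹) (by positivity)
  rw [Real.log_inv] at hlog
  have h1 : x - 2 + x⁻¹ ≤ 2 * h ^ 2 := by
    have : x - 2 + x⁻¹ = (1 - x) ^ 2 / x := by
      field_simp
      ring
    rw [this, div_le_iff₀ (by linarith)]
    nlinarith
  unfold poissonCost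
  linarith

lemma exp_neg_sub_sq_le {x : ℝ} (h0 : 0 ≤ x) (h1 : x ≤ 1 / 2) :
    Real.exp (-(x + x ^ 2)) ≤ 1 - x := by
  have h := Real.quadratic_le_exp_of_nonneg (x := x + x ^ 2) (by positivity)
  rw [Real.exp_neg, inv_le_iff_one_le_mul₀ (Real.exp_pos _)]
  have h2 : 0 ≤ x ^ 2 * (1 - x - x ^ 2 - x ^ 3) := by
    have h3 : x ^ 2 ≤ 1 / 4 := by nlinarith
    have h4 : x ^ 3 ≤ 1 / 8 := by
      calc x ^ 3 ≤ (1 / 2) ^ 3 := by gcongr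
        _ = 1 / 8 := by norm_num
    exact mul_nonneg (by positivity) (by linarith)
  calc (1 : ℝ) ≤ (1 - x) * (1 + (x + x ^ 2) + (x + x ^ 2) ^ 2 / 2) := by linarith
    _ ≤ (1 - x) * Real.exp (x + x ^ 2) := mul_le_mul_of_nonneg_left h (by linarith)

lemma factorial_le_exp {B : ℕ} (hB : 1 ≤ B) :
    (B.factorial : ℝ) ≤ Real.exp (1 + Real.log B + B * Real.log B - B) := by
  induction B, hB using Nat.le_induction with
  | base => simp
  | succ B hB ih =>
    have hB0 : (0 : ℝ) < B := by exact_mod_cast hB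
    have hlog := Real.one_sub_inv_le_log_of_pos (x := ((B : ℝ) + 1) / B) (by positivity)
    rw [Real.log_div (by positivity) (by positivity), inv_div] at hlog
    have h1 : 1 ≤ (B + 1) * (Real.log (B + 1) - Real.log B) := by
      have : ((B : ℝ) + 1) * (1 - B / (B + 1)) = 1 := by field_simp; ring
      calc (1 : ℝ) = (B + 1) * (1 - B / (B + 1)) := this.symm
        _ ≤ _ := mul_le_mul_of_nonneg_left hlog (by positivity)
    rw [Nat.factorial_succ]
    push_cast
    calc ((B : ℝ) + 1) * B.factorial
        ≤ Real.exp (Real.log (B + 1)) * Real.exp (1 + Real.log B + B * Real.log B - B) := by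
          rw [Real.exp_log (by positivity)]
          gcongr
      _ ≤ _ := by
          rw [← Real.exp_add]
          apply Real.exp_le_exp.2
          nlinarith

/-- Lower bound for the binomial probability of attaching exactly `B` vertices. -/
lemma exp_le_choose_mul {n N B : ℕ} {d x : ℝ} (hB : 1 ≤ B) (hx0 : 0 < x) (hx1 : x ≤ 1)
    (hn : 2 * B ^ 2 ≤ n) (hBN : B ≤ N) (hN : Real.exp (-d) * n ≤ N + 1 - B) :
    Real.exp (-(B * poissonCost x + B * d + 2 + Real.log B)) ≤
      N.choose B * (B * x / n) ^ B * (1 - B * x / n) ^ n := by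
  have hB0 : (0 : ℝ) < B := by exact_mod_cast hB
  have hB1 : (1 : ℝ) ≤ B := by exact_mod_cast hB
  have hnB : (2 : ℝ) * B ^ 2 ≤ n := by exact_mod_cast hn
  have hn0 : (0 : ℝ) < n := by nlinarith
  have hσ0 : 0 ≤ B * x / n := by positivity
  have hσ : B * x / n ≤ 1 / 2 := by
    rw [div_le_iff₀ hn0]
    nlinarith
  have h1 : Real.exp (-(B * x + 1)) ≤ (1 - B * x / n) ^ n := by
    calc Real.exp (-(B * x + 1)) ≤ Real.exp (-(B * x / n + (B * x / n) ^ 2)) ^ n := by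
          rw [← Real.exp_nat_mul]
          apply Real.exp_le_exp.2
          have : (n : ℝ) * -(B * x / n + (B * x / n) ^ 2) = -(B * x + (B * x) ^ 2 / n) := by
            field_simp
          rw [this]
          have : (B * x) ^ 2 / n ≤ 1 := by
            rw [div_le_one hn0]
            calc ((B : ℝ) * x) ^ 2 ≤ ((B : ℝ) * 1) ^ 2 := by gcongr
              _ ≤ (n : ℝ) := by nlinarith
          linarith
      _ ≤ _ := by
          gcongr
          exact exp_neg_sub_sq_le hσ0 hσ
  have h2 : (Real.exp (-d) * n) ^ B / Real.exp (1 + Real.log B + B * Real.log B - B)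
      ≤ N.choose B := by
    have h3 := Nat.pow_sub_le_descFactorial N B
    have h4 : ((N : ℝ) + 1 - B) ^ B ≤ N.descFactorial B := by
      have : ((N : ℝ) + 1 - B) = ((N + 1 - B : ℕ) : ℝ) := by
        rw [Nat.cast_sub (by omega)]
        push_cast
        ring
      rw [this]
      exact_mod_cast h3
    rw [Nat.choose_eq_descFactorial_div_factorial,
      Nat.cast_div (Nat.factorial_dvd_descFactorial N B) (by positivity)]
    gcongr
    · exact (pow_le_pow_left₀ (by positivity) hN B).trans h4
    · exact factorial_le_exp hB
  calc Real.exp (-(B * poissonCost x + B * d + 2 + Real.log B))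
      = (Real.exp (-d) * n) ^ B / Real.exp (1 + Real.log B + B * Real.log B - B) *
          (B * x / n) ^ B * Real.exp (-(B * x + 1)) := by
        have e1 : (Real.exp (-d) * n) ^ B * (B * x / n) ^ B
            = Real.exp (B * (-d + (Real.log B + Real.log x))) := by
          rw [Real.exp_nat_mul, Real.exp_add, Real.exp_add, Real.exp_log hB0, Real.exp_log hx0,
            ← mul_pow]
          congr 1
          field_simp
        rw [div_mul_eq_mul_div, e1, ← Real.exp_sub, ← Real.exp_add]
        congr 1
        unfold poissonCost
        ring
    _ ≤ _ := by
        gcongr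

/-- The exponential cost of the remaining subcritical part of an exploration in rounds of size `B`
whose current offspring mean is `x`. -/
noncomputable def remainingCost (ℓ r : ℝ) (B : ℕ) (x : ℝ) : ℝ :=
  ℓ / r * (costPrimitive 1 - costPrimitive x) + B * poissonCost x

lemma remainingCost_nonneg {ℓ r x : ℝ} {B : ℕ} (hℓ : 0 < ℓ) (hr : 0 < r) (hx0 : 0 < x)
    (hx1 : x ≤ 1) : 0 ≤ remainingCost ℓ r B x := by
  have h := mul_poissonCost_le hx0 hx1 le_rfl
  have h1 : poissonCost 1 = 0 := by simp [poissonCost]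
  rw [h1, mul_zero] at h
  have h2 := poissonCost_nonneg hx0
  unfold remainingCost
  positivity

lemma remainingCost_step {ℓ r x : ℝ} {B : ℕ} (hℓ : 0 < ℓ) (hr : 0 < r) (hx0 : 0 < x)
    (hx1 : x + B * r / ℓ ≤ 1) :
    B * poissonCost x + remainingCost ℓ r B (x + B * r / ℓ) ≤ remainingCost ℓ r B x := by
  have h := mul_poissonCost_le hx0 (le_add_of_nonneg_right (by positivity : 0 ≤ B * r / ℓ)) hx1
  have h1 := mul_le_mul_of_nonneg_left h (by positivity : 0 ≤ ℓ / r)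
  have h2 : ℓ / r * ((x + B * r / ℓ - x) * poissonCost (x + B * r / ℓ))
      = B * poissonCost (x + B * r / ℓ) := by
    field_simp
    ring
  rw [h2] at h1
  unfold remainingCost
  linarith

lemma remainingCost_one_sub {ε r ℓ : ℝ} {B : ℕ} :
    remainingCost ℓ r B (1 - ε) = -(Ier ε r * ℓ) + B * poissonCost (1 - ε) := by
  unfold remainingCost costPrimitive Ier
  simp only [Real.log_one]
  ring

lemma le_prodBern_cl_card_of_rate {n N B K m : ℕ} {ε r d p₂ p₃ : ℝ} (hε0 : 0 < ε) (hε1 : ε < 1)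
    (hr : 0 < r) (hd : 0 < d) (hB : 1 ≤ B) (hL : 1 ≤ Real.log n) (hn : 2 * B ^ 2 ≤ n)
    (hBN : B ≤ N) (hN : Real.exp (-d) * n ≤ N + 1 - B) (hp₂ : p₂ = (1 - ε) / n)
    (hp₃ : p₃ = r / (n * Real.log n)) (hp₃1 : p₃ ≤ 1) (hh : B * r / Real.log n ≤ 1 / 2)
    (hh2 : 2 * (B * r / Real.log n) ^ 2 ≤ d) (hK : K ≤ m * B)
    (U : Finset (Fin n)) (hU : N + (m + 1) * B + 1 ≤ U.card) (v : Fin n) (hv : v ∈ U) :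
    (1 / (B : ℝ)) ^ B * Real.exp (-(B * poissonCost (1 - ε) + B * d + 2 + Real.log B)) *
      Real.exp (Ier ε r * Real.log n - B * poissonCost (1 - ε)
        - m * (2 * B * d + 2 + Real.log B)) ≤
      (prodBern (edgeProb n p₂ p₃)).real {ω | K ≤ (cl ω U v).card} := by
  set ℓ := Real.log n with hℓ
  have hℓ0 : 0 < ℓ := by linarith
  have hB1 : (1 : ℝ) ≤ B := by exact_mod_cast hB
  have hnB : (2 : ℝ) * B ^ 2 ≤ n := by exact_mod_cast hn
  have hn0 : (0 : ℝ) < n := by nlinarith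
  have hn1 : (1 : ℝ) ≤ n := by nlinarith
  have hε' : 0 < 1 - ε := by linarith
  have h₂ : 0 ≤ p₂ ∧ p₂ ≤ 1 := by
    rw [hp₂]
    exact ⟨by positivity, by rw [div_le_one hn0]; linarith⟩
  have h₃ : 0 ≤ p₃ ∧ p₃ ≤ 1 := ⟨by rw [hp₃]; positivity, hp₃1⟩
  set M := ⌊ε * ℓ / r⌋₊ with hM
  set c := 2 * B * d + 2 + Real.log B with hc
  let x : ℕ → ℝ := fun y => 1 - ε + r * y / ℓ
  have hσ : ∀ y : ℕ, B * p₂ + B * y * p₃ = B * x y / n := by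
    intro y
    rw [hp₂, hp₃]
    simp only [x]
    field_simp
  have hx0 : ∀ y, 0 < x y := fun y => by
    have : 0 ≤ r * y / ℓ := by positivity
    simp only [x]
    linarith
  have hx1 : ∀ y ≤ M, x y ≤ 1 := fun y hy => by
    have h1 : (y : ℝ) ≤ ε * ℓ / r := (Nat.le_floor_iff (by positivity)).1 hy
    have h2 : r * y / ℓ ≤ ε := by
      rw [div_le_iff₀ hℓ0]
      rw [le_div_iff₀ hr] at h1
      linarith
    simp only [x]
    linarith
  have key := le_prodBern_cl_card h₂ h₃ (B := B) (M := M) (N := N) (K := K) (m := m)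
    (fun i y => Real.exp (-(remainingCost ℓ r B (x y) + i * c))) ?_ ?_ ?_ ?_ hK U hU v hv
  · refine le_trans ?_ key
    have h1 := exp_le_choose_mul hB hε' (by linarith) hn hBN hN
    have hx : x 0 = 1 - ε := by simp [x]
    have h2 : (1 - B * (1 - ε) / n) ^ n ≤ (1 - p₂) ^ n := by
      have h3 : B * (1 - ε) / n ≤ 1 := by
        rw [div_le_one hn0]
        nlinarith
      refine pow_le_pow_left₀ (by linarith) ?_ n
      rw [hp₂]
      gcongr
      nlinarith
    have h3 : (1 / (B : ℝ)) ^ B * (B * (1 - ε) / n) ^ B = p₂ ^ B := by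
      rw [hp₂, ← mul_pow]
      congr 1
      field_simp
    calc _ ≤ (1 / (B : ℝ)) ^ B * (N.choose B * (B * (1 - ε) / n) ^ B *
            (1 - B * (1 - ε) / n) ^ n) *
          Real.exp (-(remainingCost ℓ r B (x 0) + m * c)) := by
          rw [hx, remainingCost_one_sub]
          refine mul_le_mul (by gcongr) (le_of_eq ?_) (Real.exp_pos _).le ?_
          · congr 1
            ring
          · exact mul_nonneg (by positivity) ((Real.exp_pos _).le.trans h1)
      _ = N.choose B * p₂ ^ B * (1 - B * (1 - ε) / n) ^ n *
            Real.exp (-(remainingCost ℓ r B (x 0) + m * c)) := by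
          rw [← h3]
          ring
      _ ≤ _ := by
          have := h₂.1
          gcongr
  · intro y hy
    rw [Real.exp_le_one_iff]
    have := remainingCost_nonneg (B := B) hℓ0 hr (hx0 y) (hx1 y hy)
    simp only [Nat.cast_zero, zero_mul]
    linarith
  · intro i y
    exact (Real.exp_pos _).le
  · intro y hy
    rw [hσ, div_le_one hn0]
    nlinarith [hx1 y hy, hx0 y]
  · intro i y hy
    rw [hσ]
    have h1 := exp_le_choose_mul hB (hx0 y) (hx1 y hy) hn hBN hN
    refine le_trans ?_ (mul_le_mul_of_nonneg_right h1 (Real.exp_pos _).le)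
    rw [← Real.exp_add]
    apply Real.exp_le_exp.2
    have hBd : 0 ≤ B * d := by positivity
    split_ifs with hyM
    · have hxB : x (y + B) = x y + B * r / ℓ := by
        simp only [x]
        push_cast
        ring
      have h2 := remainingCost_step (B := B) hℓ0 hr (hx0 y) (by rw [← hxB]; exact hx1 _ hyM)
      rw [hxB]
      push_cast
      linarith
    · have h2 : 1 ≤ x y + B * r / ℓ := by
        have h3 : ε * ℓ / r < y + B := by
          have := (Nat.floor_lt (by positivity)).1 (not_le.1 hyM)
          exact_mod_cast this
        rw [div_lt_iff₀ hr] at h3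
        have h4 : ε ≤ r * y / ℓ + B * r / ℓ := by
          rw [← add_div, le_div_iff₀ hℓ0]
          linarith
        simp only [x]
        linarith
      have h5 := (poissonCost_le_of_near_one (hx1 y hy) hh h2).trans hh2
      have h6 : B * poissonCost (x y) ≤ B * d := by gcongr
      push_cast
      linarith

end RateFunction

section Assembly

lemma prodBern_propConnected_ge {n K : ℕ} (hn : 2 ≤ n) {p : EdgeIdx n → ℝ}
    (hp : ∀ e, 0 ≤ p e ∧ p e ≤ 1) {a b : ℝ}
    (ha : (prodBern p).real
      {ω | ∀ v ∈ (Finset.univ : Finset (Fin n)), (cl ω Finset.univ v).card < K} ≤ a)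
    (hb : (prodBern p).real
      {ω | ∃ v, K ≤ (cl ω Finset.univ v).card ∧ (cl ω Finset.univ v).card < n} ≤ b) :
    1 - a - b ≤ (prodBern p).real {ω | PropConnected ω} := by
  have := isProbabilityMeasure_prodBern hp
  have hsub : (Set.univ : Set (EdgeIdx n → Bool)) ⊆ {ω | PropConnected ω} ∪
      ({ω | ∀ v ∈ (Finset.univ : Finset (Fin n)), (cl ω Finset.univ v).card < K} ∪
        {ω | ∃ v, K ≤ (cl ω Finset.univ v).card ∧ (cl ω Finset.univ v).card < n}) := by
    intro ω _
    by_contra h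
    simp only [Set.mem_union, Set.mem_ofPred_eq, not_or, not_forall, not_exists, not_and,
      not_lt] at h
    obtain ⟨h1, ⟨v, _, hv⟩, h2⟩ := h
    refine h1 (propConnected_of_cl_eq_univ hn (v := v) ((Finset.card_eq_iff_eq_univ _).1 ?_))
    exact le_antisymm (Finset.card_le_univ _) (by simpa using h2 v hv)
  have h1 := measureReal_mono (μ := prodBern p) hsub
  have h2 := measureReal_union_le (μ := prodBern p) {ω | PropConnected ω}
      ({ω | ∀ v ∈ (Finset.univ : Finset (Fin n)), (cl ω Finset.univ v).card < K} ∪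
        {ω | ∃ v, K ≤ (cl ω Finset.univ v).card ∧ (cl ω Finset.univ v).card < n})
  have h3 := measureReal_union_le (μ := prodBern p)
      {ω | ∀ v ∈ (Finset.univ : Finset (Fin n)), (cl ω Finset.univ v).card < K}
      {ω | ∃ v, K ≤ (cl ω Finset.univ v).card ∧ (cl ω Finset.univ v).card < n}
  rw [probReal_univ] at h1
  linarith

lemma eventually_log_le_mul {c : ℝ} (hc : 0 < c) :
    ∀ᶠ n : ℕ in atTop, Real.log n ≤ c * n := by
  filter_upwards [tendsto_natCast_atTop_atTop.eventually
    (Real.isLittleO_log_id_atTop.bound hc)] with n hn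
  simpa using (le_abs_self _).trans hn

lemma eventually_log_sq_le_mul {c : ℝ} (hc : 0 < c) :
    ∀ᶠ n : ℕ in atTop, Real.log n ^ 2 ≤ c * n := by
  filter_upwards [tendsto_natCast_atTop_atTop.eventually
    ((Real.isLittleO_pow_log_id_atTop (n := 2)).bound hc)] with n hn
  simpa using (le_abs_self _).trans hn

lemma eventually_le_natCast (x : ℝ) : ∀ᶠ n : ℕ in atTop, x ≤ n :=
  tendsto_natCast_atTop_atTop.eventually_ge_atTop x

lemma eventually_le_log (x : ℝ) : ∀ᶠ n : ℕ in atTop, x ≤ Real.log n :=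
  (Real.tendsto_log_atTop.comp tendsto_natCast_atTop_atTop).eventually_ge_atTop x

lemma exists_block_size {d : ℝ} (hd : 0 < d) :
    ∃ B : ℕ, 1 ≤ B ∧ 2 + Real.log B ≤ d * B := by
  obtain ⟨B, h1, h2, h3⟩ := ((eventually_ge_atTop 1).and
    ((eventually_log_le_mul (half_pos hd)).and (eventually_le_natCast (2 / (d / 2))))).exists
  refine ⟨B, h1, ?_⟩
  rw [div_le_iff₀ (half_pos hd)] at h3
  linarith

/-- The number of disjoint blocks of size `K` available for restarting the exploration. -/
lemma le_mul_restarts {n K B N₀ : ℕ} {d κ : ℝ} (hκ : 0 < κ)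
    (hδ : 0 < 1 - Real.exp (-d)) (hL : 1 ≤ κ * Real.log n)
    (hKdef : K = ⌈κ * Real.log n⌉₊)
    (hN₀ : N₀ = ⌈Real.exp (-d) * n⌉₊ + B + (K / B + 1 + 1) * B + 1)
    (hn1 : Real.log n ≤ (1 - Real.exp (-d)) / (8 * κ) * n)
    (hn2 : 4 * (5 + 3 * B) / (1 - Real.exp (-d)) ≤ n) :
    (1 - Real.exp (-d)) * n / (4 * κ * Real.log n) ≤ ((n - N₀) / K : ℕ) ∧
      N₀ + (n - N₀) / K * K ≤ n := by
  have hL0 : 0 < Real.log n := pos_of_mul_pos_right (by linarith) hκ.le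
  have hK1 : (K : ℝ) < κ * Real.log n + 1 := by
    rw [hKdef]
    exact Nat.ceil_lt_add_one (by linarith)
  have hK0 : 0 < K := by
    rw [hKdef]
    exact Nat.ceil_pos.2 (by linarith)
  have hKB : K / B * B ≤ K := Nat.div_mul_le_self K B
  have hceil := Nat.ceil_lt_add_one (a := Real.exp (-d) * n) (by positivity)
  have hN₀' : (N₀ : ℝ) ≤ Real.exp (-d) * n + κ * Real.log n + 3 + 3 * B := by
    have : (N₀ : ℝ) = ⌈Real.exp (-d) * n⌉₊ + ((K / B * B : ℕ) : ℝ) + 3 * B + 1 := by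
      rw [hN₀]
      push_cast
      ring
    have h2 : ((K / B * B : ℕ) : ℝ) ≤ K := by exact_mod_cast hKB
    rw [this]
    linarith
  have hlog : κ * Real.log n ≤ (1 - Real.exp (-d)) / 8 * n := by
    calc κ * Real.log n ≤ κ * ((1 - Real.exp (-d)) / (8 * κ) * n) := by gcongr
      _ = _ := by field_simp
  rw [div_le_iff₀ hδ] at hn2
  have hle : N₀ ≤ n := by
    have : (N₀ : ℝ) ≤ n := by linarith
    exact_mod_cast this
  have hdiv := Nat.div_add_mod (n - N₀) K
  have hmod := Nat.mod_lt (n - N₀) hK0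
  have hmul : n - N₀ ≤ (n - N₀) / K * K + K := by
    rw [mul_comm]
    omega
  refine ⟨?_, ?_⟩
  · rw [div_le_iff₀ (by positivity)]
    have h1 : ((n : ℝ) - N₀) ≤ ((n - N₀) / K : ℕ) * K + K := by
      rw [← Nat.cast_sub hle]
      exact_mod_cast hmul
    have h2 : (((n - N₀) / K : ℕ) : ℝ) * K ≤ ((n - N₀) / K : ℕ) * (2 * κ * Real.log n) := by
      gcongr
      linarith
    linarith
  · have := Nat.div_mul_le_self (n - N₀) K
    omega

/-- The number of restarts dominates the inverse of the success probability of each of them. -/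
lemma mul_log_le_restarts_mul {I κ d γ c c₀ P δ L n T m K B : ℝ} (hκ : 0 < κ)
    (hγ : 0 < γ) (hδ : 0 < δ) (hL : 0 < L) (hc₀ : 0 < c₀) (hn : Real.exp L = n) (hB : 1 ≤ B)
    (hIγ : I - 3 * d * κ = -1 + γ) (hc0 : 0 ≤ c) (hc : c ≤ 3 * d * B) (hm : m ≤ K / B + 1)
    (hK : K ≤ κ * L + 1) (hT : δ * n / (4 * κ * L) ≤ T) :
    δ / (4 * κ) * c₀ * Real.exp (-(P + 3 * d + c)) * (γ ^ 2 / 2) * L ≤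
      T * (c₀ * Real.exp (I * L - P - m * c)) := by
  have hmc : m * c ≤ 3 * d * κ * L + 3 * d + c := by
    have h1 : c / B ≤ 3 * d := by
      rw [div_le_iff₀ (by linarith)]
      exact hc
    have hc' : 0 ≤ c / B := by positivity
    calc m * c ≤ (K / B + 1) * c := by gcongr
      _ = K * (c / B) + c := by ring
      _ ≤ (κ * L + 1) * (c / B) + c := by gcongr
      _ ≤ (κ * L + 1) * (3 * d) + c := by gcongr
      _ = _ := by ring
  have h2 : Real.exp (-(P + 3 * d + c)) * Real.exp (γ * L) / n ≤
      Real.exp (I * L - P - m * c) := by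
    rw [← hn, ← Real.exp_add, ← Real.exp_sub]
    apply Real.exp_le_exp.2
    have : I * L = 3 * d * κ * L + (-1 + γ) * L := by
      rw [← hIγ]
      ring
    linarith
  have h3 := Real.quadratic_le_exp_of_nonneg (x := γ * L) (by positivity)
  have hn0 : 0 < n := hn ▸ Real.exp_pos L
  calc δ / (4 * κ) * c₀ * Real.exp (-(P + 3 * d + c)) * (γ ^ 2 / 2) * L
      = δ * n / (4 * κ * L) * (c₀ * (Real.exp (-(P + 3 * d + c)) * ((γ * L) ^ 2 / 2) / n)) := by
        field_simp
    _ ≤ δ * n / (4 * κ * L) * (c₀ * (Real.exp (-(P + 3 * d + c)) * Real.exp (γ * L) / n)) := by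
        gcongr
        have : 0 ≤ γ * L := by positivity
        linarith
    _ ≤ _ := by
        have : 0 ≤ T := le_trans (by positivity) hT
        gcongr

lemma exists_eventually_le_prodBern_propConnected {ε r : ℝ} (hε0 : 0 < ε) (hε1 : ε < 1)
    (hr : 0 < r) (hI : -1 < Ier ε r) :
    ∃ c : ℝ, 0 < c ∧ ∀ᶠ n : ℕ in atTop,
      1 - Real.exp (-(c * Real.log n)) - Real.exp (-(2 * Real.log n)) ≤
        (prodBern (edgeProb n ((1 - ε) / n) (r / (n * Real.log n)))).real
          {ω | PropConnected ω} := by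
  obtain ⟨κ, hκ4, hκr⟩ : ∃ κ : ℝ, 4 ≤ κ ∧ 64 ≤ κ * r :=
    ⟨4 + 64 / r, by linarith [show 0 < 64 / r by positivity], by
      rw [add_mul, div_mul_cancel₀ _ hr.ne']
      linarith⟩
  have hκ : 0 < κ := by linarith
  obtain ⟨d, hd, hdκ⟩ : ∃ d : ℝ, 0 < d ∧ 3 * d * κ = (1 + Ier ε r) / 4 :=
    ⟨(1 + Ier ε r) / (12 * κ), div_pos (by linarith) (by positivity), by
      field_simp
      ring⟩
  obtain ⟨B, hB, hBd⟩ := exists_block_size hd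
  have hB1 : (1 : ℝ) ≤ B := by exact_mod_cast hB
  have hδ : 0 < 1 - Real.exp (-d) := by
    rw [sub_pos, Real.exp_lt_one_iff]
    linarith
  set P := B * poissonCost (1 - ε) with hP
  set c := 2 * B * d + 2 + Real.log B with hc
  have hlogB : 0 ≤ Real.log B := Real.log_nonneg hB1
  set c₀ := (1 / (B : ℝ)) ^ B * Real.exp (-(P + B * d + 2 + Real.log B)) with hc₀
  have hc₀0 : 0 < c₀ := by positivity
  set γ := 3 * (1 + Ier ε r) / 4 with hγ
  have hγ0 : 0 < γ := by
    rw [hγ]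
    linarith
  refine ⟨(1 - Real.exp (-d)) / (4 * κ) * c₀ * Real.exp (-(P + 3 * d + c)) * (γ ^ 2 / 2),
    by positivity, ?_⟩
  filter_upwards [eventually_ge_atTop 4, eventually_ge_atTop (2 * B ^ 2), eventually_le_log 1,
    eventually_log_sq_le_mul (show 0 < r / 64 by positivity), eventually_le_natCast r,
    eventually_le_log (B * r / (1 / 2)), eventually_le_log (2 * (B * r) ^ 2 / d),
    eventually_log_le_mul (show 0 < (1 - Real.exp (-d)) / (8 * κ) by positivity),
    eventually_le_natCast (4 * (5 + 3 * B) / (1 - Real.exp (-d)))]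
    with n hn4 hnB hL hLr hnr hLB hLd hn1 hn2
  have hn4' : (4 : ℝ) ≤ n := by exact_mod_cast hn4
  have hL0 : 0 < Real.log n := by linarith
  have hκL : 4 ≤ κ * Real.log n := by nlinarith
  have hp₃ : r / (n * Real.log n) ≤ 1 := by
    rw [div_le_one (by positivity)]
    nlinarith
  have hprob : ∀ e, 0 ≤ edgeProb n ((1 - ε) / n) (r / (n * Real.log n)) e ∧
      edgeProb n ((1 - ε) / n) (r / (n * Real.log n)) e ≤ 1 :=
    edgeProb_mem ⟨div_nonneg (by linarith) (by linarith), by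
      rw [div_le_one (by linarith)]
      linarith⟩ ⟨by positivity, hp₃⟩
  set K := ⌈κ * Real.log n⌉₊ with hK
  set N := ⌈Real.exp (-d) * n⌉₊ + B with hN
  set m := K / B + 1 with hm
  obtain ⟨hT, hTn⟩ := le_mul_restarts (N₀ := N + (m + 1) * B + 1) hκ hδ (by linarith) hK rfl
    hn1 hn2
  set T := (n - (N + (m + 1) * B + 1)) / K with hTdef
  refine prodBern_propConnected_ge (K := K) (by omega) hprob ?_ ?_
  · set s := c₀ * Real.exp (Ier ε r * Real.log n - P - m * c) with hs
    have hKm : K ≤ m * B := by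
      rw [hm]
      have h1 := Nat.div_add_mod K B
      have h2 := Nat.mod_lt K (show 0 < B by omega)
      rw [add_mul, one_mul, mul_comm]
      omega
    have hsle : ∀ U : Finset (Fin n), N + (m + 1) * B + 1 ≤ U.card → ∀ v ∈ U,
        s ≤ (prodBern (edgeProb n ((1 - ε) / n) (r / (n * Real.log n)))).real
          {ω | K ≤ (cl ω U v).card} := fun U hU v hv => by
      refine le_prodBern_cl_card_of_rate hε0 hε1 hr hd hB hL hnB (by omega) ?_ rfl rfl hp₃
        ?_ ?_ hKm U hU v hv
      · rw [hN]
        push_cast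
        linarith [Nat.le_ceil (Real.exp (-d) * n)]
      · rw [div_le_iff₀ (by norm_num)] at hLB
        rw [div_le_iff₀ hL0]
        linarith
      · rw [div_le_iff₀ hd] at hLd
        rw [div_pow, mul_div_assoc', div_le_iff₀ (by positivity)]
        nlinarith
    have hrate := prodBern_all_cl_card_lt_le hprob (by omega) hsle T Finset.univ
      (by simpa using hTn)
    have hTs := mul_log_le_restarts_mul (I := Ier ε r) (κ := κ) (d := d) (γ := γ) (c := c)
      (c₀ := c₀) (P := P) (m := m) (K := K) (B := B) hκ hγ0 hδ hL0 hc₀0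
      (Real.exp_log (by linarith)) hB1 (by rw [hdκ, hγ]; ring) (by positivity)
      (by rw [hc]; linarith)
      (by
        rw [hm]
        push_cast
        gcongr
        exact Nat.cast_div_le)
      (Nat.ceil_lt_add_one (by linarith)).le hT
    have hs1 : s ≤ 1 := by
      have := isProbabilityMeasure_prodBern hprob
      exact (hsle Finset.univ (by simpa using (Nat.le_add_right _ _).trans hTn) ⟨0, by omega⟩
        (Finset.mem_univ _)).trans measureReal_le_one
    calc _ ≤ (1 - s) ^ T := hrate
      _ ≤ Real.exp (-s) ^ T := by
        refine pow_le_pow_left₀ (by linarith) ?_ T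
        linarith [Real.add_one_le_exp (-s)]
      _ ≤ _ := by
        rw [← Real.exp_nat_mul]
        apply Real.exp_le_exp.2
        linarith
  · have hLr' : 64 * Real.log n ^ 2 ≤ n * r := by linarith
    refine prodBern_exists_cl_le_exp hr hn4 (div_nonneg (by linarith) (by linarith)) ?_ rfl hκ4
      hκr hL hLr' hp₃ (Nat.le_ceil _)
    gcongr
    linarith

end Assembly

/-- If `I_{ε,r} > -1` then w.h.p. `𝔾(n,p₂,p₃)` is propagation connected. -/
theorem propagation_connected (ε r : ℝ) (hε0 : 0 < ε) (hε1 : ε < 1) (hr : 0 < r)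
    (hI : -1 < Ier ε r) :
    Tendsto (fun n : ℕ => hypMeasure n ε r {ω | PropConnected ω}) atTop (nhds 1) := by
  obtain ⟨c, hc, hev⟩ := exists_eventually_le_prodBern_propConnected hε0 hε1 hr hI
  have hlog : Tendsto (fun n : ℕ => Real.log n) atTop atTop :=
    Real.tendsto_log_atTop.comp tendsto_natCast_atTop_atTop
  have hexp : ∀ a : ℝ, 0 < a →
      Tendsto (fun n : ℕ => Real.exp (-(a * Real.log n))) atTop (nhds 0) := fun a ha =>
    Real.tendsto_exp_neg_atTop_nhds_zero.comp (hlog.const_mul_atTop ha)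
  have hlim : Tendsto (fun n : ℕ => ENNReal.ofReal
      (1 - Real.exp (-(c * Real.log n)) - Real.exp (-(2 * Real.log n)))) atTop (nhds 1) := by
    have := ENNReal.tendsto_ofReal (((tendsto_const_nhds (x := (1 : ℝ))).sub (hexp c hc)).sub
      (hexp 2 two_pos))
    simpa using this
  refine tendsto_of_tendsto_of_tendsto_of_le_of_le' hlim tendsto_const_nhds ?_ ?_
  · filter_upwards [hev] with n hn
    exact ENNReal.ofReal_le_of_le_toReal hn
  · filter_upwards [eventually_le_log 1, eventually_le_natCast (max 1 r)] with n hL hn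
    have hn1 := (le_max_left _ _).trans hn
    have hnr := (le_max_right _ _).trans hn
    have hprob := edgeProb_mem (n := n) (p₂ := (1 - ε) / n) (p₃ := r / (n * Real.log n))
      ⟨div_nonneg (by linarith) (by linarith), by
        rw [div_le_one (by linarith)]
        linarith⟩ ⟨by positivity, by
        rw [div_le_one (by nlinarith)]
        nlinarith⟩
    have := isProbabilityMeasure_prodBern hprob
    exact prob_le_one (μ := prodBern (edgeProb n ((1 - ε) / n) (r / (n * Real.log n))))
end

section
/- Let K₀ = max{1, 2(9+ε)/r}. For every δ > 0 there exists N such that for all n ≥ N and every vertex v₀ of 𝔾(n,p₂,p₃), the probability that the propagation component of v₀ satisfies |C_{v₀}| ≥ K₀·ln n is at most n^{I_{ε,r}+δ}. -/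
open MeasureTheory Real Filter

/-- `f 0, …, f (k-1)` is a propagation sequence from the vertex set `S`:
every `f l` is an edge and meets `S ∪ f 0 ∪ ⋯ ∪ f (l-1)` in all but exactly
one vertex. -/
def IsPropSeqFrom {n : ℕ} (ω : EdgeIdx n → Bool) (S : Finset (Fin n))
    (k : ℕ) (f : ℕ → Finset (Fin n)) : Prop :=
  (∀ i < k, IsEdge ω (f i)) ∧
  ∀ l < k, (f l ∩ (S ∪ (Finset.range l).biUnion f)).card = (f l).card - 1

/-- The propagation component of the vertex set `S`: the union of `S` with all
edges occurring in propagation sequences from `S`. -/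
def propComponent {n : ℕ} (ω : EdgeIdx n → Bool) (S : Finset (Fin n)) : Set (Fin n) :=
  ↑S ∪ {x | ∃ k f, IsPropSeqFrom ω S k f ∧ ∃ i < k, x ∈ f i}

/-- Edges which, together with the processed set `P` and the vertex `v`, would reach `x`. -/
def testedEdges {n : ℕ} (P : Finset (Fin n)) (v x : Fin n) : Finset (EdgeIdx n) :=
  Finset.univ.filter fun e => x ∈ e.1 ∧ v ∈ e.1 ∧ e.1.erase x ⊆ insert v P

/-- Vertices outside `P ∪ Q` that are reached when the vertex `v` is processed after `P`. -/
def newlyActive {n : ℕ} (ω : EdgeIdx n → Bool) (P Q : Finset (Fin n)) (v : Fin n) :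
    Finset (Fin n) :=
  (P ∪ Q)ᶜ.filter fun x => ∃ e ∈ testedEdges P v x, ω e = true

/-- The exploration with processed set `P` and active set `Q`, processing the least active
vertex at each step, still has an active vertex after `k` further steps. -/
def Survives {n : ℕ} (ω : EdgeIdx n → Bool) : ℕ → Finset (Fin n) → Finset (Fin n) → Prop
  | 0, _, Q => Q.Nonempty
  | k + 1, P, Q => ∃ h : Q.Nonempty, Survives ω k (insert (Q.min' h) P)
      (Q.erase (Q.min' h) ∪ newlyActive ω P Q (Q.min' h))

lemma not_survives_empty {n : ℕ} (ω : EdgeIdx n → Bool) (k : ℕ) (P : Finset (Fin n)) :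
    ¬ Survives ω k P ∅ := by
  cases k <;> simp [Survives]

lemma propComponent_subset_of_closed {n : ℕ} {ω : EdgeIdx n → Bool} {S P : Finset (Fin n)}
    (hS : S ⊆ P) (hP : ∀ e, IsEdge ω e → ∀ x ∈ e, e.erase x ⊆ P → x ∈ P) :
    propComponent ω S ⊆ ↑P := by
  rintro x (hx | ⟨k, f, ⟨hedge, hcard⟩, i, hi, hx⟩)
  · exact hS hx
  · suffices h : ∀ l < k, f l ⊆ P from h i hi hx
    intro l
    induction l using Nat.strong_induction_on with
    | _ l ih =>
      intro hl
      set W := S ∪ (Finset.range l).biUnion f with hW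
      have hWP : W ⊆ P := by
        refine Finset.union_subset hS (Finset.biUnion_subset.2 fun j hj => ?_)
        exact ih j (Finset.mem_range.1 hj) ((Finset.mem_range.1 hj).trans hl)
      have h1 : (f l \ W).card = 1 := by
        have h2 := Finset.card_inter_add_card_sdiff (f l) W
        have h3 := hcard l hl
        rw [← hW] at h3
        obtain ⟨h4, -⟩ := hedge l hl
        omega
      obtain ⟨y, hy⟩ := Finset.card_eq_one.1 h1
      have hout : ∀ z ∈ f l, z ≠ y → z ∈ P := by
        intro z hz hzy
        by_contra hzP
        have : z ∈ f l \ W := Finset.mem_sdiff.2 ⟨hz, fun h => hzP (hWP h)⟩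
        rw [hy, Finset.mem_singleton] at this
        exact hzy this
      have hyf : y ∈ f l := by
        have : y ∈ f l \ W := by simp [hy]
        exact (Finset.mem_sdiff.1 this).1
      have hyP : y ∈ P := hP _ (hedge l hl) y hyf fun z hz =>
        hout z (Finset.mem_of_mem_erase hz) (Finset.ne_of_mem_erase hz)
      intro z hz
      by_cases hzy : z = y
      · exact hzy ▸ hyP
      · exact hout z hz hzy

lemma ncard_propComponent_le_of_not_survives {n : ℕ} {ω : EdgeIdx n → Bool}
    {S : Finset (Fin n)} (k : ℕ) (P Q : Finset (Fin n)) (hS : S ⊆ P ∪ Q)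
    (hPQ : ∀ e, IsEdge ω e → ∀ x ∈ e, e.erase x ⊆ P → x ∈ P ∪ Q)
    (h : ¬ Survives ω k P Q) : (propComponent ω S).ncard ≤ P.card + k := by
  have hempty : Q = ∅ → (propComponent ω S).ncard ≤ P.card := by
    rintro rfl
    rw [Finset.union_empty] at hS hPQ
    have := Set.ncard_le_ncard (propComponent_subset_of_closed hS hPQ) P.finite_toSet
    rwa [Set.ncard_coe_finset] at this
  induction k generalizing P Q with
  | zero => exact hempty (Finset.not_nonempty_iff_eq_empty.1 h)
  | succ k ih =>
    rcases Q.eq_empty_or_nonempty with hQ | hQ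
    · exact (hempty hQ).trans (Nat.le_add_right _ _)
    · simp only [Survives, not_exists] at h
      have hv := Q.min'_mem hQ
      have h' := h hQ
      set v := Q.min' hQ
      have hmem : ∀ x, x ∈ P ∪ Q → x ∈ insert v P ∪ (Q.erase v ∪ newlyActive ω P Q v) := by
        intro x hx
        simp only [Finset.mem_union, Finset.mem_insert, Finset.mem_erase] at hx ⊢
        tauto
      have hcl : ∀ e, IsEdge ω e → ∀ x ∈ e, e.erase x ⊆ insert v P →
          x ∈ insert v P ∪ (Q.erase v ∪ newlyActive ω P Q v) := by
        intro e he x hx hsub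
        by_cases hxPQ : x ∈ P ∪ Q
        · exact hmem x hxPQ
        by_cases hve : v ∈ e
        · obtain ⟨hc, hω⟩ := he
          have : x ∈ newlyActive ω P Q v := by
            refine Finset.mem_filter.2 ⟨Finset.mem_compl.2 hxPQ, ⟨e, hc⟩, ?_, hω⟩
            simp [testedEdges, hx, hve, hsub]
          simp [this]
        · refine absurd (hPQ e he x hx fun z hz => ?_) hxPQ
          rcases Finset.mem_insert.1 (hsub hz) with rfl | h
          · exact absurd (Finset.mem_of_mem_erase hz) hve
          · exact h
      refine (ih (insert v P) _ (fun x hx => hmem x (hS hx)) hcl h' ?_).trans ?_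
      · intro h0
        rw [h0, Finset.union_empty] at hcl
        have hSv : S ⊆ insert v P := fun x hx => by
          have := hmem x (hS hx)
          rwa [h0, Finset.union_empty] at this
        have := Set.ncard_le_ncard (propComponent_subset_of_closed hSv hcl)
          (insert v P).finite_toSet
        rwa [Set.ncard_coe_finset] at this
      · have := Finset.card_insert_le v P
        omega

/-- Edges on which the exploration from processed set `P` and active set `Q` may still depend. -/
def untestedEdges {n : ℕ} (P Q : Finset (Fin n)) : Finset (EdgeIdx n) :=
  Finset.univ.filter fun e => ∃ x ∈ e.1, x ∉ P ∪ Q ∧ ¬ e.1.erase x ⊆ P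

lemma survives_congr {n : ℕ} {ω ω' : EdgeIdx n → Bool} (k : ℕ) (P Q : Finset (Fin n))
    (hPQ : Disjoint P Q) (h : ∀ e ∈ untestedEdges P Q, ω e = ω' e) :
    Survives ω k P Q ↔ Survives ω' k P Q := by
  induction k generalizing P Q with
  | zero => rfl
  | succ k ih =>
    refine exists_congr fun hQ => ?_
    have hv := Q.min'_mem hQ
    set v := Q.min' hQ
    have hvP : v ∉ P := Finset.disjoint_right.1 hPQ hv
    have hnew : newlyActive ω P Q v = newlyActive ω' P Q v := by
      refine Finset.filter_congr fun x hx => exists_congr fun e => and_congr_right fun he => ?_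
      rw [h e]
      simp only [testedEdges, Finset.mem_filter, Finset.mem_univ, true_and] at he
      rw [Finset.mem_compl] at hx
      refine Finset.mem_filter.2 ⟨Finset.mem_univ _, x, he.1, hx, fun hsub => ?_⟩
      refine hvP (hsub (Finset.mem_erase.2 ⟨?_, he.2.1⟩))
      rintro rfl
      exact hx (Finset.mem_union_right _ hv)
    rw [← hnew]
    refine ih _ _ ?_ fun e he => h e ?_
    · rw [Finset.disjoint_left] at hPQ ⊢
      intro x hx hx'
      simp only [newlyActive, Finset.mem_union, Finset.mem_insert, Finset.mem_erase,
        Finset.mem_filter, Finset.mem_compl] at hx hx'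
      have := @hPQ x
      rcases hx with rfl | hx <;> tauto
    · simp only [untestedEdges, Finset.mem_filter, Finset.mem_univ, true_and] at he ⊢
      obtain ⟨x, hx, hx1, hx2⟩ := he
      refine ⟨x, hx, fun hx3 => hx1 ?_, fun h3 => hx2 (h3.trans (Finset.subset_insert _ _))⟩
      simp only [Finset.mem_union, Finset.mem_insert, Finset.mem_erase] at hx3 ⊢
      tauto

lemma disjoint_testedEdges {n : ℕ} {P : Finset (Fin n)} {v x y : Fin n}
    (hy : y ∉ insert v P) (hxy : y ≠ x) :
    Disjoint (testedEdges P v x) (testedEdges P v y) := by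
  rw [Finset.disjoint_left]
  intro e he he'
  simp only [testedEdges, Finset.mem_filter, Finset.mem_univ, true_and] at he he'
  exact hy (he.2.2 (Finset.mem_erase.2 ⟨hxy, he'.1⟩))

lemma disjoint_testedEdges_untestedEdges {n : ℕ} {P Q : Finset (Fin n)} {v x : Fin n} :
    Disjoint (testedEdges P v x) (untestedEdges (insert v P) Q) := by
  rw [Finset.disjoint_left]
  intro e he he'
  simp only [testedEdges, untestedEdges, Finset.mem_filter, Finset.mem_univ, true_and] at he he'
  obtain ⟨y, hy, hy1, hy2⟩ := he'
  by_cases hxy : y = x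
  · exact hy2 (hxy ▸ he.2.2)
  · exact hy1 (Finset.mem_union_left _ (he.2.2 (Finset.mem_erase.2 ⟨hxy, hy⟩)))

lemma pi_real_inter_eq_mul {ι : Type*} [Fintype ι] [DecidableEq ι] (ν : ι → Measure Bool)
    [∀ i, IsProbabilityMeasure (ν i)] {E F : Set (ι → Bool)} {S T : Finset ι}
    (hST : Disjoint S T) (hE : DependsOn (· ∈ E) (S : Set ι))
    (hF : DependsOn (· ∈ F) (T : Set ι)) :
    (Measure.pi ν).real (E ∩ F) = (Measure.pi ν).real E * (Measure.pi ν).real F := by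
  have hind : ProbabilityTheory.iIndepFun (fun i (ω : ι → Bool) => ω i) (Measure.pi ν) :=
    ProbabilityTheory.iIndepFun_pi (X := fun _ => id) fun i => measurable_id.aemeasurable
  have h2 := hind.indepFun_finset S T hST fun i => measurable_pi_apply i
  have key : ∀ (G : Set (ι → Bool)) (R : Finset ι), DependsOn (· ∈ G) (R : Set ι) →
      (fun (ω : ι → Bool) (i : R) => ω i) ⁻¹' ((fun (ω : ι → Bool) (i : R) => ω i) '' G) = G := by
    intro G R hG
    refine subset_antisymm ?_ (Set.subset_preimage_image _ _)
    rintro ω ⟨ω', hω', heq⟩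
    have : (ω' ∈ G) = (ω ∈ G) := hG fun i hi => congrFun heq ⟨i, hi⟩
    exact this ▸ hω'
  have h3 := h2.measure_inter_preimage_eq_mul _ _
    (Set.toFinite ((fun (ω : ι → Bool) (i : S) => ω i) '' E)).measurableSet
    (Set.toFinite ((fun (ω : ι → Bool) (i : T) => ω i) '' F)).measurableSet
  rw [key E S hE, key F T hF] at h3
  simp only [Measure.real, h3, ENNReal.toReal_mul]

lemma dependsOn_mem_biInter {ι J : Type*} [DecidableEq ι] {α : ι → Type*} (U : Finset J)
    {E : J → Set (∀ i, α i)} {S : J → Finset ι}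
    (hE : ∀ j ∈ U, DependsOn (· ∈ E j) (S j : Set ι)) :
    DependsOn (· ∈ ⋂ j ∈ U, E j) (U.biUnion S : Set ι) := by
  intro ω ω' h
  simp only [Set.mem_iInter, eq_iff_iff]
  refine forall₂_congr fun j hj => iff_of_eq (hE j hj fun i hi => h i ?_)
  exact Finset.mem_biUnion.2 ⟨j, hj, hi⟩

lemma pi_real_biInter_eq_prod {ι J : Type*} [Fintype ι] [DecidableEq ι]
    (ν : ι → Measure Bool) [∀ i, IsProbabilityMeasure (ν i)] (U : Finset J)
    {E : J → Set (ι → Bool)} {S : J → Finset ι} (hS : (U : Set J).PairwiseDisjoint S)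
    (hE : ∀ j ∈ U, DependsOn (· ∈ E j) (S j : Set ι)) :
    (Measure.pi ν).real (⋂ j ∈ U, E j) = ∏ j ∈ U, (Measure.pi ν).real (E j) := by
  classical
  induction U using Finset.induction_on with
  | empty => simp
  | insert a U ha ih =>
    have hE' : ∀ j ∈ U, DependsOn (· ∈ E j) (S j : Set ι) := fun j hj =>
      hE j (Finset.mem_insert_of_mem hj)
    rw [Finset.set_biInter_insert, Finset.prod_insert ha, ← ih (hS.subset (by simp)) hE']
    refine pi_real_inter_eq_mul ν ?_ (hE a (Finset.mem_insert_self _ _))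
      (dependsOn_mem_biInter U hE')
    rw [Finset.disjoint_biUnion_right]
    intro j hj
    exact hS (by simp) (by simp [hj]) (by rintro rfl; exact ha hj)

lemma sum_testedEdges_le {n : ℕ} {P : Finset (Fin n)} {v x : Fin n} (hxv : v ≠ x) {a b : ℝ}
    (ha : 0 ≤ a) (hb : 0 ≤ b) :
    ∑ e ∈ testedEdges P v x, (if e.1.card = 2 then a else b) ≤ a + P.card * b := by
  have hdecomp : ∀ e ∈ testedEdges P v x,
      e.1 = insert x (insert v ((e.1.erase x).erase v)) ∧
      ((e.1.erase x).erase v).card + 2 = e.1.card ∧ (e.1.erase x).erase v ⊆ P := by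
    intro e he
    simp only [testedEdges, Finset.mem_filter, Finset.mem_univ, true_and] at he
    have hv : v ∈ e.1.erase x := Finset.mem_erase.2 ⟨hxv, he.2.1⟩
    refine ⟨by rw [Finset.insert_erase hv, Finset.insert_erase he.1], ?_, fun z hz => ?_⟩
    · have h1 := Finset.card_erase_add_one hv
      have h2 := Finset.card_erase_add_one he.1
      omega
    · have hz' := he.2.2 (Finset.mem_of_mem_erase hz)
      exact (Finset.mem_insert.1 hz').resolve_left (Finset.ne_of_mem_erase hz)
  have h2 : ((testedEdges P v x).filter fun e => e.1.card = 2).card ≤ 1 := by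
    rw [Finset.card_le_one]
    intro e he e' he'
    rw [Finset.mem_filter] at he he'
    have key : ∀ d ∈ testedEdges P v x, d.1.card = 2 → d.1 = {x, v} := by
      intro d hd hd2
      obtain ⟨h1, h3, -⟩ := hdecomp d hd
      rw [h1, Finset.card_eq_zero.1 (by omega : ((d.1.erase x).erase v).card = 0)]
      rfl
    exact Subtype.ext ((key e he.1 he.2).trans (key e' he'.1 he'.2).symm)
  have h3 : ((testedEdges P v x).filter fun e => ¬ e.1.card = 2).card ≤ P.card := by
    refine le_trans (Finset.card_le_card_of_injOn (t := P.image fun u => {x, v, u})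
      (fun e => e.1) ?_ Subtype.val_injective.injOn) Finset.card_image_le
    intro e he
    rw [Finset.mem_coe, Finset.mem_filter] at he
    obtain ⟨h1, h4, h5⟩ := hdecomp e he.1
    have hc : ((e.1.erase x).erase v).card = 1 := by
      have := e.2
      omega
    obtain ⟨u, hu⟩ := Finset.card_eq_one.1 hc
    refine Finset.mem_coe.2 (Finset.mem_image.2 ⟨u, h5 (by simp [hu]), ?_⟩)
    rw [hu] at h1
    exact h1.symm
  rw [Finset.sum_ite, Finset.sum_const, Finset.sum_const, nsmul_eq_mul, nsmul_eq_mul]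
  gcongr
  · have : (((testedEdges P v x).filter fun e => e.1.card = 2).card : ℝ) ≤ 1 := by
      exact_mod_cast h2
    nlinarith

lemma pi_real_newlyActive_inter_survives {n : ℕ} (ν : EdgeIdx n → Measure Bool)
    [∀ e, IsProbabilityMeasure (ν e)] (k : ℕ) {P Q A : Finset (Fin n)} {v : Fin n}
    (hPQ : Disjoint P Q) (hv : v ∈ Q) (hA : A ⊆ (P ∪ Q)ᶜ) :
    (Measure.pi ν).real ({ω | newlyActive ω P Q v = A} ∩
        {ω | Survives ω k (insert v P) (Q.erase v ∪ A)}) =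
      ((∏ x ∈ A, (Measure.pi ν).real {ω | ∃ e ∈ testedEdges P v x, ω e = true}) *
        ∏ x ∈ (P ∪ Q)ᶜ \ A,
          (1 - (Measure.pi ν).real {ω | ∃ e ∈ testedEdges P v x, ω e = true})) *
        (Measure.pi ν).real {ω | Survives ω k (insert v P) (Q.erase v ∪ A)} := by
  set hit : Fin n → Set (EdgeIdx n → Bool) :=
    fun x => {ω | ∃ e ∈ testedEdges P v x, ω e = true} with hhit
  set U := (P ∪ Q)ᶜ with hU
  have hnotin : ∀ x ∈ U, x ∉ insert v P := by
    intro x hx hx'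
    rw [hU, Finset.mem_compl, Finset.mem_union] at hx
    rcases Finset.mem_insert.1 hx' with rfl | h
    · exact hx (Or.inr hv)
    · exact hx (Or.inl h)
  let E : Fin n → Set (EdgeIdx n → Bool) := fun x => if x ∈ A then hit x else (hit x)ᶜ
  have hdep : ∀ x, DependsOn (· ∈ E x) (testedEdges P v x : Set (EdgeIdx n)) := by
    intro x ω ω' h
    have : ω ∈ hit x ↔ ω' ∈ hit x :=
      exists_congr fun e => and_congr_right fun he => by rw [h e he]
    by_cases hx : x ∈ A <;> simp [E, hx, this]
  have hdepE := dependsOn_mem_biInter U (E := E) (S := testedEdges P v) fun x _ => hdep x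
  have hprod := pi_real_biInter_eq_prod ν U (E := E) (S := testedEdges P v)
    (fun x _ y hy hxy => disjoint_testedEdges (hnotin y hy) hxy.symm) fun x _ => hdep x
  have heq : {ω | newlyActive ω P Q v = A} = ⋂ x ∈ U, E x := by
    ext ω
    simp only [Set.mem_ofPred_eq, Set.mem_iInter]
    constructor
    · rintro rfl x hx
      by_cases hx' : x ∈ newlyActive ω P Q v
      · simp only [E, hx', if_true]
        exact (Finset.mem_filter.1 hx').2
      · simp only [E, hx', if_false]
        exact fun h => hx' (Finset.mem_filter.2 ⟨hx, h⟩)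
    · intro h
      ext x
      constructor
      · intro hx
        obtain ⟨hx1, hx2⟩ := Finset.mem_filter.1 hx
        by_contra hxA
        have := h x hx1
        simp only [E, hxA, if_false] at this
        exact this hx2
      · intro hx
        have := h x (hA hx)
        simp only [E, hx, if_true] at this
        exact Finset.mem_filter.2 ⟨hA hx, this⟩
  have hdisj : Disjoint (insert v P) (Q.erase v ∪ A) := by
    rw [Finset.disjoint_left] at hPQ ⊢
    intro x hx hx'
    rcases Finset.mem_union.1 hx' with h | h
    · rcases Finset.mem_insert.1 hx with rfl | h1
      · exact Finset.notMem_erase _ _ h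
      · exact hPQ h1 (Finset.mem_of_mem_erase h)
    · exact hnotin x (hA h) hx
  rw [heq, pi_real_inter_eq_mul ν _ hdepE (T := untestedEdges (insert v P) (Q.erase v ∪ A)), hprod]
  · congr 1
    rw [← Finset.prod_sdiff hA, mul_comm]
    congr 1
    · refine Finset.prod_congr rfl fun x hx => ?_
      simp only [E, hx, if_true, hhit]
    · refine Finset.prod_congr rfl fun x hx => ?_
      simp only [E, (Finset.mem_sdiff.1 hx).2, if_false]
      exact probReal_compl_eq_one_sub (Set.toFinite _).measurableSet
  · intro ω ω' h
    exact propext (survives_congr k _ _ hdisj h)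
  · rw [Finset.disjoint_biUnion_left]
    exact fun x _ => disjoint_testedEdges_untestedEdges

lemma pi_real_survives_le {n : ℕ} (ν : EdgeIdx n → Measure Bool)
    [∀ e, IsProbabilityMeasure (ν e)] {lam θ : ℕ → ℝ} (hθ : ∀ i, 1 ≤ θ i) (hanti : Antitone θ)
    (hlam : ∀ i, 0 ≤ lam i)
    (hhit : ∀ (P : Finset (Fin n)) (v x : Fin n), v ≠ x →
      ∑ e ∈ testedEdges P v x, (ν e).real {true} ≤ lam P.card / n)
    (k : ℕ) (P Q : Finset (Fin n)) (hPQ : Disjoint P Q) :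
    θ P.card * (Measure.pi ν).real {ω | Survives ω k P Q} ≤
      θ P.card ^ Q.card * ∏ j ∈ Finset.range k,
        (Real.exp (lam (P.card + j) * (θ (P.card + j) - 1)) / θ (P.card + j)) := by
  have hpos : ∀ i, 0 < θ i := fun i => one_pos.trans_le (hθ i)
  have hC : ∀ i k, 0 ≤ ∏ j ∈ Finset.range k,
      (Real.exp (lam (i + j) * (θ (i + j) - 1)) / θ (i + j)) := fun i k =>
    Finset.prod_nonneg fun j _ => div_nonneg (Real.exp_pos _).le (hpos _).le
  induction k generalizing P Q with
  | zero =>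
    rcases Q.eq_empty_or_nonempty with rfl | hQ
    · simp [Survives]
    · simp only [Finset.range_zero, Finset.prod_empty, mul_one]
      calc θ P.card * (Measure.pi ν).real {ω | Survives ω 0 P Q} ≤ θ P.card * 1 :=
            mul_le_mul_of_nonneg_left measureReal_le_one (hpos _).le
        _ ≤ θ P.card ^ Q.card := by
            rw [mul_one]
            exact le_self_pow₀ (hθ _) hQ.card_pos.ne'
  | succ k ih =>
    rcases Q.eq_empty_or_nonempty with rfl | hQ
    · simp only [not_survives_empty, Set.ofPred_false, measureReal_empty, mul_zero]
      exact mul_nonneg (pow_nonneg (hpos _).le _) (hC _ _)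
    have hv := Q.min'_mem hQ
    set v := Q.min' hQ with hvdef
    have hvP : v ∉ P := Finset.disjoint_right.1 hPQ hv
    set U := (P ∪ Q)ᶜ with hU
    set i := P.card with hi
    set h : Fin n → ℝ :=
      fun x => (Measure.pi ν).real {ω | ∃ e ∈ testedEdges P v x, ω e = true} with hh
    set C := ∏ j ∈ Finset.range k,
      (Real.exp (lam (i + 1 + j) * (θ (i + 1 + j) - 1)) / θ (i + 1 + j)) with hCdef
    have hC0 : 0 ≤ C := hC _ _
    have hP' : (insert v P).card = i + 1 := Finset.card_insert_of_notMem hvP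
    have hQ' : (Q.erase v).card + 1 = Q.card := Finset.card_erase_add_one hv
    have hvU : ∀ x ∈ U, v ≠ x := by
      rintro x hx rfl
      exact Finset.mem_compl.1 hx (Finset.mem_union_right _ hv)
    have h0 : ∀ x, 0 ≤ h x := fun x => measureReal_nonneg
    have h1 : ∀ x, h x ≤ 1 := fun x => measureReal_le_one
    have hle : ∀ x ∈ U, h x ≤ lam i / n := by
      intro x hx
      refine le_trans ?_ (hhit P v x (hvU x hx))
      have : {ω : EdgeIdx n → Bool | ∃ e ∈ testedEdges P v x, ω e = true} =
          ⋃ e ∈ testedEdges P v x, Function.eval e ⁻¹' {true} := by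
        ext ω; simp
      rw [hh]
      simp only [this]
      refine (measureReal_biUnion_finset_le _ _).trans (Finset.sum_le_sum fun e _ => le_of_eq ?_)
      exact (measurePreserving_eval ν e).measureReal_preimage
        (MeasurableSet.singleton _).nullMeasurableSet
    have hsub : {ω | Survives ω (k + 1) P Q} ⊆ ⋃ A ∈ U.powerset,
        ({ω | newlyActive ω P Q v = A} ∩
          {ω | Survives ω k (insert v P) (Q.erase v ∪ A)}) := by
      rintro ω ⟨_, hω⟩
      simp only [Set.mem_iUnion]
      exact ⟨newlyActive ω P Q v, Finset.mem_powerset.2 (Finset.filter_subset _ _), rfl, hω⟩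
    have hdisj : ∀ A ⊆ U, Disjoint (insert v P) (Q.erase v ∪ A) := by
      intro A hA
      rw [Finset.disjoint_left] at hPQ ⊢
      intro x hx hx'
      have hxU := @hA x
      simp only [hU, Finset.mem_union, Finset.mem_insert, Finset.mem_erase,
        Finset.mem_compl] at hx hx' hxU
      have := @hPQ x
      rcases hx with rfl | hx <;> tauto
    have hsurv : ∀ A ∈ U.powerset,
        θ i * (Measure.pi ν).real {ω | Survives ω k (insert v P) (Q.erase v ∪ A)} ≤
          θ i ^ (Q.erase v).card * θ i ^ A.card * C := by
      intro A hA
      rw [Finset.mem_powerset] at hA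
      have hcard : (Q.erase v ∪ A).card = (Q.erase v).card + A.card := by
        refine Finset.card_union_of_disjoint (Finset.disjoint_left.2 fun x hx hx' => ?_)
        exact Finset.mem_compl.1 (hA hx')
          (Finset.mem_union_right _ (Finset.mem_of_mem_erase hx))
      rw [← pow_add, ← hcard]
      rcases (Q.erase v ∪ A).eq_empty_or_nonempty with hemp | hne
      · simp only [hemp, not_survives_empty, Set.ofPred_false, measureReal_empty, mul_zero]
        simpa using hC0
      obtain ⟨m, hm⟩ := Nat.exists_eq_succ_of_ne_zero hne.card_pos.ne'
      have := ih (insert v P) (Q.erase v ∪ A) (hdisj A hA)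
      rw [hP', hm, Nat.succ_eq_add_one, pow_succ', mul_assoc, mul_le_mul_iff_right₀ (hpos _)]
        at this
      rw [hm, Nat.succ_eq_add_one, pow_succ', mul_assoc, mul_le_mul_iff_right₀ (hpos _)]
      refine this.trans (mul_le_mul_of_nonneg_right ?_ hC0)
      exact pow_le_pow_left₀ (hpos _).le (hanti (Nat.le_succ i)) m
    have hfac : ∀ x ∈ U, h x * θ i + (1 - h x) ≤ Real.exp (lam i * (θ i - 1) / n) := by
      intro x hx
      refine le_trans ?_ (Real.add_one_le_exp _)
      have := mul_le_mul_of_nonneg_right (hle x hx) (sub_nonneg.2 (hθ i))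
      rw [div_mul_eq_mul_div] at this
      linarith
    have hprod : ∏ x ∈ U, (h x * θ i + (1 - h x)) ≤ Real.exp (lam i * (θ i - 1)) := by
      have hnn : 0 ≤ lam i * (θ i - 1) := mul_nonneg (hlam i) (sub_nonneg.2 (hθ i))
      calc ∏ x ∈ U, (h x * θ i + (1 - h x))
          ≤ ∏ x ∈ U, Real.exp (lam i * (θ i - 1) / n) := by
            refine Finset.prod_le_prod (fun x _ => ?_) hfac
            exact add_nonneg (mul_nonneg (h0 x) (hpos i).le) (sub_nonneg.2 (h1 x))
        _ = Real.exp (U.card * (lam i * (θ i - 1) / n)) := by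
            rw [Finset.prod_const, ← Real.exp_nat_mul]
        _ ≤ Real.exp (lam i * (θ i - 1)) := by
            refine Real.exp_le_exp.2 ?_
            have hn : (0 : ℝ) < n := Nat.cast_pos.2 v.pos
            have hUn : (U.card : ℝ) ≤ n := by
              exact_mod_cast (Finset.card_le_univ U).trans_eq (Fintype.card_fin n)
            rw [mul_div_assoc', div_le_iff₀ hn, mul_comm]
            exact mul_le_mul_of_nonneg_left hUn hnn
    rw [Finset.prod_range_succ']
    simp only [add_zero]
    have hshift : ∏ j ∈ Finset.range k,
        (Real.exp (lam (i + (j + 1)) * (θ (i + (j + 1)) - 1)) / θ (i + (j + 1))) = C := by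
      refine Finset.prod_congr rfl fun j _ => ?_
      rw [add_right_comm, add_assoc]
    rw [hshift]
    calc θ i * (Measure.pi ν).real {ω | Survives ω (k + 1) P Q}
        ≤ θ i * ∑ A ∈ U.powerset, ((∏ x ∈ A, h x) * ∏ x ∈ U \ A, (1 - h x)) *
            (Measure.pi ν).real {ω | Survives ω k (insert v P) (Q.erase v ∪ A)} := by
          refine mul_le_mul_of_nonneg_left ?_ (hpos _).le
          refine (measureReal_mono hsub (measure_ne_top _ _)).trans
            ((measureReal_biUnion_finset_le _ _).trans_eq ?_)
          refine Finset.sum_congr rfl fun A hA => ?_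
          exact pi_real_newlyActive_inter_survives ν k hPQ hv (Finset.mem_powerset.1 hA)
      _ ≤ ∑ A ∈ U.powerset, (θ i ^ (Q.erase v).card * C) *
            ((∏ x ∈ A, h x * θ i) * ∏ x ∈ U \ A, (1 - h x)) := by
          rw [Finset.mul_sum]
          refine Finset.sum_le_sum fun A hA => ?_
          have hw : 0 ≤ (∏ x ∈ A, h x) * ∏ x ∈ U \ A, (1 - h x) :=
            mul_nonneg (Finset.prod_nonneg fun x _ => h0 x)
              (Finset.prod_nonneg fun x _ => sub_nonneg.2 (h1 x))
          have := mul_le_mul_of_nonneg_left (hsurv A hA) hw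
          rw [Finset.prod_mul_distrib, Finset.prod_const]
          linarith
      _ = (θ i ^ (Q.erase v).card * C) * ∏ x ∈ U, (h x * θ i + (1 - h x)) := by
          rw [Finset.prod_add, Finset.mul_sum]
      _ ≤ (θ i ^ (Q.erase v).card * C) * Real.exp (lam i * (θ i - 1)) :=
          mul_le_mul_of_nonneg_left hprod (mul_nonneg (pow_nonneg (hpos _).le _) hC0)
      _ = θ i ^ Q.card * (C * (Real.exp (lam i * (θ i - 1)) / θ i)) := by
          rw [← hQ', pow_succ]
          have := (hpos i).ne'
          field_simp

lemma one_sub_add_log_le {x y : ℝ} (hx : 0 < x) (hxy : x ≤ y) (hy : y ≤ 1) :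
    1 - x + Real.log x ≤ 1 - y + Real.log y := by
  have hy0 : 0 < y := hx.trans_le hxy
  have h := Real.log_le_sub_one_of_pos (div_pos hx hy0)
  rw [Real.log_div hx.ne' hy0.ne'] at h
  have h2 : y - x ≤ 1 - x / y := by
    have h3 : 1 - x / y = (y - x) / y := by field_simp
    rw [h3, le_div_iff₀ hy0]
    nlinarith
  linarith

lemma one_sub_add_log_mul_le {x y : ℝ} (hx : 0 < x) (hxy : x ≤ y) (hy : y ≤ 1) :
    (1 - x + Real.log x) * (y - x) ≤
      (y * Real.log y - y ^ 2 / 2) - (x * Real.log x - x ^ 2 / 2) := by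
  rcases hxy.eq_or_lt with rfl | hlt
  · simp
  have hderiv : ∀ z, 0 < z →
      HasDerivAt (fun z => z * Real.log z - z ^ 2 / 2) (1 - z + Real.log z) z := by
    intro z hz
    have h1 := (Real.hasDerivAt_mul_log hz.ne').sub ((hasDerivAt_pow 2 z).div_const 2)
    refine h1.congr_deriv ?_
    norm_num
    ring
  obtain ⟨c, ⟨hc1, hc2⟩, hc⟩ := exists_hasDerivAt_eq_slope
    (fun z => z * Real.log z - z ^ 2 / 2) (fun z => 1 - z + Real.log z) hlt
    (fun z hz => (hderiv z (hx.trans_le hz.1)).continuousAt.continuousWithinAt)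
    (fun z hz => hderiv z (hx.trans hz.1))
  rw [eq_div_iff (sub_pos.2 hlt).ne'] at hc
  rw [← hc]
  exact mul_le_mul_of_nonneg_right (one_sub_add_log_le hx hc1.le (hc2.le.trans hy))
    (sub_pos.2 hlt).le

lemma sum_one_sub_add_log_le {a h : ℝ} (ha : 0 < a) (hh : 0 < h) (k : ℕ) (hk : a + k * h ≤ 1)
    (hk' : 1 ≤ a + (k + 1) * h) :
    h * ∑ j ∈ Finset.range k, (1 - (a + j * h) + Real.log (a + j * h)) ≤
      -(1 / 2) - (a * Real.log a - a ^ 2 / 2) - h * (1 - a + Real.log a) := by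
  have hle1 : ∀ j : ℕ, j ≤ k → a + j * h ≤ 1 := by
    intro j hj
    have : (j : ℝ) * h ≤ k * h := by gcongr
    linarith
  have hpos : ∀ j : ℕ, 0 < a + j * h := fun j => by positivity
  set G : ℝ → ℝ := fun z => z * Real.log z - z ^ 2 / 2 with hG
  have hsum : h * ∑ j ∈ Finset.range k, (1 - (a + j * h) + Real.log (a + j * h)) ≤
      G (a + k * h) - G a := by
    have htel := Finset.sum_range_sub (fun j : ℕ => G (a + j * h)) k
    simp only [Nat.cast_zero, zero_mul, add_zero] at htel
    rw [← htel, Finset.mul_sum]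
    refine Finset.sum_le_sum fun j hj => ?_
    have hjk : j + 1 ≤ k := Finset.mem_range.1 hj
    have := one_sub_add_log_mul_le (hpos j) (y := a + (j + 1 : ℕ) * h)
      (by push_cast; linarith) (hle1 _ hjk)
    refine le_trans (le_of_eq ?_) this
    push_cast
    ring
  have hlast := one_sub_add_log_mul_le (hpos k) hk le_rfl
  have hmono := one_sub_add_log_le ha (y := a + k * h)
    (le_add_of_nonneg_right (by positivity)) hk
  have hneg : 1 - (a + k * h) + Real.log (a + k * h) ≤ 0 := by
    have := Real.log_le_sub_one_of_pos (hpos k)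
    linarith
  have h5 : h * (1 - a + Real.log a) ≤
      (1 - (a + k * h) + Real.log (a + k * h)) * (1 - (a + k * h)) := by
    have h6 : 1 - (a + k * h) ≤ h := by linarith
    have h7 := mul_le_mul_of_nonpos_left h6 hneg
    have h8 := mul_le_mul_of_nonneg_left hmono hh.le
    linarith
  simp only [Real.log_one, hG] at hlast hsum
  linarith

lemma bern_isProbabilityMeasure {p : ℝ} (h0 : 0 ≤ p) (h1 : p ≤ 1) :
    IsProbabilityMeasure (bern p) := by
  constructor
  simp [bern, ← ENNReal.ofReal_add h0 (sub_nonneg.2 h1)]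

lemma bern_real_true {p : ℝ} (h0 : 0 ≤ p) : (bern p).real {true} = p := by
  simp [bern, Measure.real, h0]

/-- Upper bound `n^{I_{ε,r}+o(1)}` on the probability that the propagation component
of a given vertex has at least `K₀ ln n` vertices. -/
theorem prob_component_large_upper (ε r : ℝ) (hε0 : 0 < ε) (hε1 : ε < 1) (hr : 0 < r) :
    ∀ δ > (0 : ℝ), ∃ N : ℕ, ∀ n ≥ N, ∀ v₀ : Fin n,
      hypMeasure n ε r
          {ω | K0 ε r * Real.log n ≤ ((propComponent ω {v₀}).ncard : ℝ)} ≤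
        ENNReal.ofReal ((n : ℝ) ^ (Ier ε r + δ)) := by
  intro δ hδ
  set a := 1 - ε with ha
  have ha0 : 0 < a := sub_pos.2 hε1
  have hev : ∀ᶠ n : ℕ in atTop, max (max 1 r) (-(1 - a + Real.log a) / δ) ≤ Real.log n ∧ 1 ≤ n :=
    ((Real.tendsto_log_atTop.comp tendsto_natCast_atTop_atTop).eventually_ge_atTop _).and
      (eventually_ge_atTop 1)
  obtain ⟨N, hN⟩ := eventually_atTop.1 hev
  refine ⟨N, fun n hn v₀ => ?_⟩
  obtain ⟨hL, hn1⟩ := hN n hn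
  set L := Real.log n with hLdef
  simp only [max_le_iff] at hL
  obtain ⟨⟨hL1, hLr⟩, hLδ⟩ := hL
  have hL0 : 0 < L := one_pos.trans_le hL1
  have hn1' : (1 : ℝ) ≤ n := by exact_mod_cast hn1
  have hn0 : (0 : ℝ) < n := one_pos.trans_le hn1'
  have hp2 : 0 ≤ a / n := by positivity
  have hp2' : a / n ≤ 1 := by
    rw [div_le_one hn0]
    linarith
  have hp3 : 0 ≤ r / (n * L) := by positivity
  have hp3' : r / (n * L) ≤ 1 := by
    rw [div_le_one (by positivity)]
    nlinarith
  set p : EdgeIdx n → ℝ := fun e => if e.1.card = 2 then a / n else r / (n * L) with hp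
  have hp0 : ∀ e, 0 ≤ p e := fun e => by
    simp only [hp]
    split_ifs <;> assumption
  have hprob : ∀ e, IsProbabilityMeasure (bern (p e)) := fun e =>
    bern_isProbabilityMeasure (hp0 e) (by simp only [hp]; split_ifs <;> assumption)
  have hμ : hypMeasure n ε r = Measure.pi fun e => bern (p e) := rfl
  set h := r / L with hh
  have hh0 : 0 < h := div_pos hr hL0
  set k := ⌊ε / h⌋₊ with hk
  have hkle : (k : ℝ) * h ≤ ε := by
    rw [← le_div_iff₀ hh0]
    exact Nat.floor_le (by positivity)
  have hklt : ε ≤ (k + 1) * h := by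
    rw [← div_le_iff₀ hh0]
    exact (Nat.lt_floor_add_one _).le
  have hkK : (k : ℝ) < K0 ε r * L := by
    have h1 : 2 * (9 + ε) / r * L ≤ K0 ε r * L :=
      mul_le_mul_of_nonneg_right (le_max_right _ _) hL0.le
    refine lt_of_lt_of_le ?_ h1
    have h2 : (k : ℝ) ≤ ε / h := (le_div_iff₀ hh0).2 hkle
    refine h2.trans_lt ?_
    have h3 : ε / h = ε / r * L := by
      rw [hh]
      field_simp
    rw [h3]
    gcongr
    linarith
  have hsub : {ω : EdgeIdx n → Bool | K0 ε r * L ≤ ((propComponent ω {v₀}).ncard : ℝ)} ⊆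
      {ω | Survives ω k ∅ {v₀}} := by
    intro ω hω
    by_contra hns
    have hcard := ncard_propComponent_le_of_not_survives (S := {v₀}) k ∅ {v₀} (by simp)
      (fun e he x hx hsub => by
        have h1 := Finset.card_erase_add_one hx
        have h2 := Finset.card_eq_zero.2 (Finset.subset_empty.1 hsub)
        obtain ⟨h3, -⟩ := he
        omega) hns
    rw [Finset.card_empty, zero_add] at hcard
    have hcard' : ((propComponent ω {v₀}).ncard : ℝ) ≤ k := by exact_mod_cast hcard
    have hω' : K0 ε r * L ≤ ((propComponent ω {v₀}).ncard : ℝ) := hω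
    linarith
  set lam : ℕ → ℝ := fun j => a + j * h with hlam
  have hlam0 : ∀ j, 0 < lam j := fun j => by
    simp only [hlam]
    positivity
  have hlam_mono : Monotone lam := by
    intro i j hij
    simp only [hlam]
    gcongr
  have hbound := pi_real_survives_le (fun e => bern (p e)) (lam := lam)
    (θ := fun j => max 1 (1 / lam j)) (fun j => le_max_left _ _)
    (fun i j hij => max_le_max le_rfl (one_div_le_one_div_of_le (hlam0 i) (hlam_mono hij)))
    (fun j => (hlam0 j).le)
    (fun P v x hvx => by
      simp only [bern_real_true (hp0 _)]
      refine (sum_testedEdges_le hvx hp2 hp3).trans_eq ?_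
      simp only [hlam, hh]
      field_simp) k ∅ {v₀} (Finset.disjoint_empty_left _)
  simp only [Finset.card_singleton, pow_one, zero_add, Finset.card_empty] at hbound
  have hbound' := le_of_mul_le_mul_left hbound (lt_of_lt_of_le one_pos (le_max_left _ _))
  have hterm : ∏ j ∈ Finset.range k,
      (Real.exp (lam j * (max 1 (1 / lam j) - 1)) / max 1 (1 / lam j)) =
      Real.exp (∑ j ∈ Finset.range k, (1 - lam j + Real.log (lam j))) := by
    rw [Real.exp_sum]
    refine Finset.prod_congr rfl fun j hj => ?_
    have hj1 : lam j ≤ 1 := by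
      refine (hlam_mono (Finset.mem_range.1 hj).le).trans ?_
      simp only [hlam]
      linarith
    rw [max_eq_right ((one_le_div (hlam0 j)).2 hj1), Real.exp_add, Real.exp_log (hlam0 j),
      div_div_eq_mul_div, div_one, mul_sub, mul_one_div_cancel (hlam0 j).ne', mul_one]
  have hsum := sum_one_sub_add_log_le ha0 hh0 k (by linarith) (by linarith)
  have hexp : ∑ j ∈ Finset.range k, (1 - lam j + Real.log (lam j)) ≤ L * (Ier ε r + δ) := by
    have hI : -(1 / 2) - (a * Real.log a - a ^ 2 / 2) = h * (L * Ier ε r) := by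
      rw [hh, Ier, ← ha]
      field_simp
      rw [ha]
      ring
    have h1 : h * ∑ j ∈ Finset.range k, (1 - lam j + Real.log (lam j)) ≤
        h * (L * Ier ε r - (1 - a + Real.log a)) := by
      rw [mul_sub, ← hI]
      exact hsum
    have h2 := le_of_mul_le_mul_left h1 hh0
    rw [div_le_iff₀ hδ] at hLδ
    linarith
  rw [hμ, ← ofReal_measureReal (measure_ne_top _ _)]
  refine ENNReal.ofReal_le_ofReal ?_
  calc (Measure.pi fun e => bern (p e)).real
        {ω | K0 ε r * L ≤ ((propComponent ω {v₀}).ncard : ℝ)}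
      ≤ (Measure.pi fun e => bern (p e)).real {ω | Survives ω k ∅ {v₀}} :=
        measureReal_mono hsub (measure_ne_top _ _)
    _ ≤ Real.exp (∑ j ∈ Finset.range k, (1 - lam j + Real.log (lam j))) := hterm ▸ hbound'
    _ ≤ (n : ℝ) ^ (Ier ε r + δ) := by
        rw [Real.rpow_def_of_pos hn0]
        exact Real.exp_le_exp.2 hexp
end
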